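/- arXiv:1310.1598 — 6 statements merged into one kernel-verified Lean document; each statement's English description precedes it below -/
import Mathlib

section
/- Let K be a field of characteristic 0 and let n ≥ 1. There do not exist 4-central polynomials for M_n(K); more precisely, for every polynomial p in m noncommuting variables over K, if p⁴ takes only scalar values on M_n(K), then p² already takes only scalar values on M_n(K). -/
/-- Evaluation of a noncommutative polynomial `p ∈ K⟨x_1,…,x_m⟩` at matrices
`a_1,…,a_m ∈ M_n(K)`. -/
noncomputable def ncEval {K : Type*} [Field K] {m n : ℕ}
    (p : FreeAlgebra K (Fin m)) (a : Fin m → Matrix (Fin n) (Fin n) K) :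
    Matrix (Fin n) (Fin n) K :=
  FreeAlgebra.lift K a p

open MvPolynomial in
/-- A polynomial taking scalar values on matrices over an infinite field takes scalar values on
matrices over every commutative algebra. -/
theorem nfc_scalar_ext {K : Type*} [Field K] [Infinite K] {m : ℕ} {ι : Type*} [Fintype ι]
    [DecidableEq ι] [Nonempty ι] (q : FreeAlgebra K (Fin m))
    (h : ∀ a : Fin m → Matrix ι ι K, ∃ lam : K,
      FreeAlgebra.lift K a q = lam • (1 : Matrix ι ι K))
    {R : Type*} [CommRing R] [Algebra K R] (a : Fin m → Matrix ι ι R) :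
    ∃ μ : R, FreeAlgebra.lift K a q = μ • (1 : Matrix ι ι R) := by
  classical
  let gen : Fin m → Matrix ι ι (MvPolynomial (Fin m × ι × ι) K) :=
    fun k => Matrix.of fun i j => X (k, i, j)
  have key' : ∀ (b : Fin m × ι × ι → K) (i j : ι),
      ∃ lam : K, ∀ i j, eval b (FreeAlgebra.lift K gen q i j) = (lam • (1 : Matrix ι ι K)) i j := by
    intro b i j
    obtain ⟨lam, hl⟩ := h (fun k => Matrix.of fun i j => b (k, i, j))
    refine ⟨lam, fun i j => ?_⟩
    rw [← hl]
    let φ : MvPolynomial (Fin m × ι × ι) K →ₐ[K] K := aeval b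
    have : FreeAlgebra.lift K (fun k => Matrix.of fun i j => b (k, i, j)) q
        = φ.mapMatrix (FreeAlgebra.lift K gen q) := by
      rw [← AlgHom.comp_apply]
      congr 1
      apply FreeAlgebra.hom_ext
      funext k
      ext i j
      simp [gen, φ]
    rw [this]
    simp [φ, aeval_eq_eval]
  obtain ⟨i0⟩ := ‹Nonempty ι›
  have hQ : FreeAlgebra.lift K gen q =
      (FreeAlgebra.lift K gen q i0 i0) • (1 : Matrix ι ι (MvPolynomial (Fin m × ι × ι) K)) := by
    ext1 i j
    apply MvPolynomial.funext
    intro b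
    obtain ⟨lam, hl⟩ := key' b i j
    rw [hl]
    by_cases hij : i = j
    · subst hij
      simp [hl]
    · simp [hij]
  refine ⟨aeval (fun t : Fin m × ι × ι => a t.1 t.2.1 t.2.2) (FreeAlgebra.lift K gen q i0 i0), ?_⟩
  let ψ : MvPolynomial (Fin m × ι × ι) K →ₐ[K] R :=
    aeval (fun t : Fin m × ι × ι => a t.1 t.2.1 t.2.2)
  have : FreeAlgebra.lift K a q = ψ.mapMatrix (FreeAlgebra.lift K gen q) := by
      rw [← AlgHom.comp_apply]
      congr 1
      apply FreeAlgebra.hom_ext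
      funext k
      ext i j
      simp [gen, ψ]
  rw [this, hQ]
  ext i j
  by_cases hij : i = j
  · subst hij
    simp [ψ]
  · simp [hij]

section Core

set_option linter.unusedSectionVars false

open MvPolynomial

variable {L : Type*} [Field L] {ι σ : Type*} [Fintype ι] [DecidableEq ι]

/-- Matrix coefficient. -/
noncomputable def nfcCf (γ : σ →₀ ℕ) (f : Matrix ι ι (MvPolynomial σ L)) : Matrix ι ι L :=
  f.map (coeff γ)

theorem nfcCf_add (γ : σ →₀ ℕ) (f g : Matrix ι ι (MvPolynomial σ L)) :
    nfcCf γ (f + g) = nfcCf γ f + nfcCf γ g := by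
  ext; simp [nfcCf]

theorem nfcCf_mul [DecidableEq σ] (γ : σ →₀ ℕ) (f g : Matrix ι ι (MvPolynomial σ L)) :
    nfcCf γ (f * g) = ∑ x ∈ Finset.HasAntidiagonal.antidiagonal γ, nfcCf x.1 f * nfcCf x.2 g := by
  ext i j
  simp only [nfcCf, Matrix.map_apply, Matrix.mul_apply, Matrix.sum_apply, coeff_sum, coeff_mul]
  rw [Finset.sum_comm]

/-- Leading exponent. -/
def nfcLead (mo : MonomialOrder σ) (f : Matrix ι ι (MvPolynomial σ L)) (a : σ →₀ ℕ) : Prop :=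
  ∀ γ, mo.toSyn a < mo.toSyn γ → nfcCf γ f = 0

theorem nfcLead_exists (mo : MonomialOrder σ) (f : Matrix ι ι (MvPolynomial σ L)) (hf : f ≠ 0) :
    ∃ a, nfcLead mo f a ∧ nfcCf a f ≠ 0 := by
  classical
  let S : Finset (σ →₀ ℕ) := Finset.univ.biUnion fun x : ι × ι => (f x.1 x.2).support
  have hS : ∀ γ, γ ∈ S ↔ nfcCf γ f ≠ 0 := by
    intro γ
    rw [Ne, ← Matrix.ext_iff]
    simp [S, nfcCf]
  have hne : S.Nonempty := by
    by_contra hcon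
    apply hf
    ext i j γ
    have : γ ∉ S := by
      rw [Finset.not_nonempty_iff_eq_empty.mp hcon]; simp
    rw [hS, not_not, ← Matrix.ext_iff] at this
    simpa [nfcCf] using this i j
  obtain ⟨a, ha, hmax⟩ := Finset.exists_max_image S mo.toSyn hne
  refine ⟨a, ?_, (hS a).1 ha⟩
  intro γ hγ
  by_contra hcon
  exact absurd (hmax γ ((hS γ).2 hcon)) (not_le.mpr hγ)

theorem nfcLead_mul (mo : MonomialOrder σ) {f g : Matrix ι ι (MvPolynomial σ L)} {a b : σ →₀ ℕ}
    (hf : nfcLead mo f a) (hg : nfcLead mo g b) :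
    nfcLead mo (f * g) (a + b) ∧ nfcCf (a + b) (f * g) = nfcCf a f * nfcCf b g := by
  classical
  constructor
  · intro γ hγ
    rw [nfcCf_mul]
    apply Finset.sum_eq_zero
    rintro ⟨x, y⟩ hxy
    rw [Finset.HasAntidiagonal.mem_antidiagonal] at hxy
    simp only at hxy ⊢
    rw [← hxy, map_add, map_add] at hγ
    rcases lt_or_ge (mo.toSyn a) (mo.toSyn x) with h | h
    · rw [hf x h, zero_mul]
    · rw [hg y (lt_of_not_ge fun h' => absurd (add_le_add h h') (not_le.mpr hγ)), mul_zero]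
  · rw [nfcCf_mul, Finset.sum_eq_single (a, b)]
    · rintro ⟨x, y⟩ hxy hne
      rw [Finset.HasAntidiagonal.mem_antidiagonal] at hxy
      simp only at hxy ⊢
      have h2 : mo.toSyn x + mo.toSyn y = mo.toSyn a + mo.toSyn b := by
        rw [← map_add, ← map_add, hxy]
      rcases lt_or_ge (mo.toSyn a) (mo.toSyn x) with h | h
      · rw [hf x h, zero_mul]
      · rcases h.lt_or_eq with h | h
        · rw [hg y, mul_zero]
          refine lt_of_not_ge fun h' => ?_
          exact absurd h2 (add_lt_add_of_lt_of_le h h').ne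
        · have hx : x = a := mo.toSyn.injective h
          subst hx
          have hy : y = b := add_left_cancel hxy
          subst hy
          exact absurd rfl hne
    · simp

/-- Homogeneity with respect to a system of matrices. -/
def nfcHom (Y : (σ →₀ ℕ) → Matrix ι ι L) (f : Matrix ι ι (MvPolynomial σ L)) : Prop :=
  ∀ γ, ∃ s : L, nfcCf γ f = s • Y γ

theorem nfcHom_add {Y : (σ →₀ ℕ) → Matrix ι ι L} {f g : Matrix ι ι (MvPolynomial σ L)}
    (hf : nfcHom Y f) (hg : nfcHom Y g) : nfcHom Y (f + g) := by
  intro γ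
  obtain ⟨s, hs⟩ := hf γ
  obtain ⟨t, ht⟩ := hg γ
  exact ⟨s + t, by rw [nfcCf_add, hs, ht, add_smul]⟩

theorem nfcHom_zero {Y : (σ →₀ ℕ) → Matrix ι ι L} :
    nfcHom Y (0 : Matrix ι ι (MvPolynomial σ L)) := by
  intro γ
  exact ⟨0, by ext; simp [nfcCf]⟩

theorem nfcHom_sum {Y : (σ →₀ ℕ) → Matrix ι ι L} {κ : Type*} (s : Finset κ)
    (f : κ → Matrix ι ι (MvPolynomial σ L))
    (hf : ∀ k ∈ s, nfcHom Y (f k)) : nfcHom Y (∑ k ∈ s, f k) :=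
  Finset.sum_induction f (nfcHom Y) (fun _ _ => nfcHom_add) nfcHom_zero hf

theorem nfcHom_mul {Y : (σ →₀ ℕ) → Matrix ι ι L}
    (hY : ∀ α β, ∃ c : L, c ≠ 0 ∧ Y α * Y β = c • Y (α + β))
    {f g : Matrix ι ι (MvPolynomial σ L)}
    (hf : nfcHom Y f) (hg : nfcHom Y g) : nfcHom Y (f * g) := by
  classical
  intro γ
  rw [nfcCf_mul]
  suffices h : ∀ x ∈ Finset.HasAntidiagonal.antidiagonal γ, nfcCf x.1 f * nfcCf x.2 g ∈ Submodule.span L {Y γ} by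
    obtain ⟨s, hs⟩ := Submodule.mem_span_singleton.1 (Submodule.sum_mem _ h)
    exact ⟨s, hs.symm⟩
  intro x hx
  rw [Finset.HasAntidiagonal.mem_antidiagonal] at hx
  obtain ⟨s, hs⟩ := hf x.1
  obtain ⟨t, ht⟩ := hg x.2
  obtain ⟨c, -, hc⟩ := hY x.1 x.2
  rw [hs, ht, smul_mul_smul_comm, hc, hx, smul_smul]
  exact Submodule.smul_mem _ _ (Submodule.mem_span_singleton_self _)

theorem nfcHom_monomial {Y : (σ →₀ ℕ) → Matrix ι ι L} (δ : σ →₀ ℕ) (s : L) :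
    nfcHom Y ((Y δ).map fun x => monomial δ (s * x)) := by
  classical
  intro γ
  by_cases h : δ = γ
  · subst h
    exact ⟨s, by ext; simp [nfcCf]⟩
  · exact ⟨0, by ext; simp [nfcCf, coeff_monomial, h]⟩

theorem nfc_core [CharZero L] (mo : MonomialOrder σ) (Y : (σ →₀ ℕ) → Matrix ι ι L)
    (hYm : ∀ α β, ∃ c : L, c ≠ 0 ∧ Y α * Y β = c • Y (α + β))
    (hY0 : ∀ α, Y α ≠ 0)
    (hpow : ∀ α (μ : L), Y α ^ 4 = μ • (1 : Matrix ι ι L) →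
      ∃ ν : L, Y α ^ 2 = ν • (1 : Matrix ι ι L))
    (f : Matrix ι ι (MvPolynomial σ L)) (hf : nfcHom Y f) (μ : MvPolynomial σ L)
    (h4 : f ^ 4 = μ • (1 : Matrix ι ι (MvPolynomial σ L)))
    (w : Matrix ι ι (MvPolynomial σ L)) : f ^ 2 * w = w * f ^ 2 := by
  by_cases hf0 : f = 0
  · simp [hf0]
  obtain ⟨a, ha, hane⟩ := nfcLead_exists mo f hf0
  obtain ⟨s, hs⟩ := hf a
  have hs0 : s ≠ 0 := by
    rintro rfl
    exact hane (by rw [hs, zero_smul])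
  obtain ⟨h2l, h2c⟩ := nfcLead_mul mo ha ha
  rw [← pow_two] at h2l h2c
  obtain ⟨h4l, h4c⟩ := nfcLead_mul mo h2l h2l
  rw [h2c, hs] at h4c
  have e4 : f ^ 2 * f ^ 2 = f ^ 4 := by rw [← pow_add]
  rw [e4, h4] at h4c
  set δ := a + a + (a + a)
  have hμ : nfcCf δ (μ • (1 : Matrix ι ι (MvPolynomial σ L))) = coeff δ μ • 1 := by
    ext i j
    by_cases hij : i = j
    · subst hij; simp [nfcCf]
    · simp [nfcCf, hij]
  rw [hμ] at h4c
  have hYa : Y a ^ 4 = ((s ^ 4)⁻¹ * coeff δ μ) • (1 : Matrix ι ι L) := by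
    rw [mul_smul, h4c, smul_mul_smul_comm, smul_mul_smul_comm, smul_smul]
    rw [show (s ^ 4)⁻¹ * (s * s * (s * s)) = 1 by field_simp, one_smul]
    simp only [pow_succ, pow_zero, one_mul, mul_assoc]
  obtain ⟨ν, hν⟩ := hpow a _ hYa
  have hc : nfcCf (a + a) (f ^ 2) = (s * s * ν) • (1 : Matrix ι ι L) := by
    rw [h2c, hs, smul_mul_smul_comm, ← pow_two (Y a), hν, smul_smul]
  have hν0 : ν ≠ 0 := by
    rintro rfl
    obtain ⟨c, hc0, hc⟩ := hYm a a
    rw [← pow_two, hν, zero_smul] at hc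
    exact (smul_ne_zero hc0 (hY0 _)) hc.symm
  rw [← sub_eq_zero]
  by_contra hw
  set g := f ^ 2
  set h := g * w - w * g with hh
  have hanti : g * h + h * g = 0 := by
    have : g * h + h * g = (g * g) * w - w * (g * g) := by rw [hh]; noncomm_ring
    rw [this, e4, h4]
    simp
  obtain ⟨b, hb, hbne⟩ := nfcLead_exists mo h hw
  have h1 := (nfcLead_mul mo h2l hb).2
  have h2 := (nfcLead_mul mo hb h2l).2
  have h3 : nfcCf (a + a + b) (g * h + h * g) = 0 := by
    rw [hanti]; ext; simp [nfcCf]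
  rw [nfcCf_add, h1, add_comm (a + a) b, h2, hc] at h3
  simp only [smul_mul_assoc, mul_smul_comm, one_mul, mul_one] at h3
  rw [← two_smul L, smul_smul] at h3
  exact smul_ne_zero (by simp [hs0, hν0]) hbne h3

end Core

section Group

open MvPolynomial

/-- The result for matrices indexed by a type, given a projective family of matrices. -/
theorem nfc_family {K L : Type*} [Field K] [CharZero K] [Field L] [Algebra K L] {m : ℕ} {ι : Type*}
    [Fintype ι] [DecidableEq ι] [Nonempty ι] {G : Type*} [AddCommGroup G] [Fintype G]
    (Z : G → Matrix ι ι L)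
    (hm : ∀ g h, ∃ c : L, c ≠ 0 ∧ Z g * Z h = c • Z (g + h))
    (h0 : Z 0 = 1)
    (j : ℕ) (hj : ∀ g : G, (4 * j) • g = 2 • g)
    (hspan : ∀ A : Matrix ι ι L, ∃ c : G → L, A = ∑ g, c g • Z g)
    (p : FreeAlgebra K (Fin m))
    (h4 : ∀ a : Fin m → Matrix ι ι K, ∃ lam : K,
      (FreeAlgebra.lift K a p) ^ 4 = lam • (1 : Matrix ι ι K))
    (a : Fin m → Matrix ι ι K) :
    ∃ lam : K, (FreeAlgebra.lift K a p) ^ 2 = lam • (1 : Matrix ι ι K) := by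
  classical
  have : CharZero L := charZero_of_injective_algebraMap (algebraMap K L).injective
  have hne : ∀ g, Z g ≠ 0 := by
    intro g hg
    obtain ⟨c, hc, h⟩ := hm g (-g)
    rw [hg, zero_mul, add_neg_cancel, h0] at h
    exact smul_ne_zero hc one_ne_zero h.symm
  have hpw : ∀ (g : G) (k : ℕ), ∃ c : L, c ≠ 0 ∧ Z g ^ k = c • Z (k • g) := by
    intro g k
    induction k with
    | zero => exact ⟨1, one_ne_zero, by simp [h0]⟩
    | succ k ih =>
      obtain ⟨c, hc, e⟩ := ih
      obtain ⟨d, hd, e'⟩ := hm (k • g) g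
      exact ⟨c * d, mul_ne_zero hc hd, by
        rw [pow_succ, e, smul_mul_assoc, e', smul_smul, succ_nsmul]⟩
  let π : (G →₀ ℕ) →+ G := (Finsupp.linearCombination ℕ (id : G → G)).toAddMonoidHom
  have hπ : ∀ g, π (Finsupp.single g 1) = g := by
    intro g; simp [π]
  let Y : (G →₀ ℕ) → Matrix ι ι L := fun γ => Z (π γ)
  have hYm : ∀ α β, ∃ c : L, c ≠ 0 ∧ Y α * Y β = c • Y (α + β) := by
    intro α β
    simp only [Y, map_add]
    exact hm _ _
  let lo : LinearOrder G := linearOrderOfSTO (WellOrderingRel (α := G))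
  let mo : MonomialOrder G := MonomialOrder.lex
  have hpow : ∀ α (μ : L), Y α ^ 4 = μ • (1 : Matrix ι ι L) →
      ∃ ν : L, Y α ^ 2 = ν • (1 : Matrix ι ι L) := by
    intro α μ h
    obtain ⟨c, hc, e⟩ := hpw (π α) (4 * j)
    obtain ⟨d, hd, e'⟩ := hpw (π α) 2
    refine ⟨d * c⁻¹ * μ ^ j, ?_⟩
    change Z (π α) ^ 2 = _
    change Z (π α) ^ 4 = _ at h
    rw [pow_mul, h, hj, smul_pow, one_pow] at e
    rw [e', mul_smul, e, smul_smul, mul_assoc, inv_mul_cancel₀ hc, mul_one]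
  choose c hc using fun k => hspan ((a k).map (algebraMap K L))
  let F : Fin m → Matrix ι ι (MvPolynomial G L) := fun k =>
    ∑ g, (Y (Finsupp.single g 1)).map fun x => monomial (Finsupp.single g 1) (c k g * x)
  have hF : ∀ k, nfcHom Y (F k) := fun k => nfcHom_sum _ _ fun g _ => nfcHom_monomial _ _
  have hC : ∀ s : L, nfcHom Y ((s • (1 : Matrix ι ι L)).map (C : L →+* MvPolynomial G L)) := by
    intro s
    have := nfcHom_monomial (Y := Y) 0 s
    have e : Y 0 = 1 := by simp [Y, h0]
    convert this using 1
    rw [e]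
    ext i j : 2
    by_cases hij : i = j
    · subst hij; simp
    · simp [hij]
  have hfh : ∀ q : FreeAlgebra K (Fin m), nfcHom Y (FreeAlgebra.lift K F q) := by
    intro q
    induction q using FreeAlgebra.induction with
    | grade0 r =>
      rw [AlgHom.commutes]
      convert hC (algebraMap K L r) using 1
      ext i j : 2
      by_cases hij : i = j
      · subst hij; simp [Matrix.algebraMap_matrix_apply, Algebra.algebraMap_eq_smul_one, coeff_one]
      · simp [Matrix.algebraMap_matrix_apply, hij]
    | grade1 x => simpa using hF x
    | mul x y hx hy => rw [map_mul]; exact nfcHom_mul hYm hx hy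
    | add x y hx hy => rw [map_add]; exact nfcHom_add hx hy
  obtain ⟨μ, hμ⟩ := nfc_scalar_ext (p ^ 4) (fun a => by simpa using h4 a) F
  rw [map_pow] at hμ
  have hcomm := nfc_core mo Y hYm (fun α => hne _) hpow _ (hfh p) μ hμ
  let ev : MvPolynomial G L →ₐ[K] L := (aeval (fun _ => (1 : L))).restrictScalars K
  have hev : ev.mapMatrix (FreeAlgebra.lift K F p) =
      (Algebra.ofId K L).mapMatrix (FreeAlgebra.lift K a p) := by
    rw [← AlgHom.comp_apply, ← AlgHom.comp_apply]
    congr 1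
    apply FreeAlgebra.hom_ext
    funext k
    have e1 : (Algebra.ofId K L).mapMatrix (a k) = (a k).map (algebraMap K L) := rfl
    simp only [Function.comp_apply, AlgHom.comp_apply, FreeAlgebra.lift_ι_apply, e1, hc]
    simp only [F, map_sum]
    refine Finset.sum_congr rfl fun g _ => ?_
    ext i j
    simp [ev, eval_monomial, Y, hπ]
  have hK : ∀ A : Matrix ι ι K, Commute ((FreeAlgebra.lift K a p) ^ 2) A := by
    intro A
    have h1 := congrArg ev.mapMatrix (hcomm ((A.map (algebraMap K L)).map C))
    have h2 : ev.mapMatrix ((A.map (algebraMap K L)).map C) = (Algebra.ofId K L).mapMatrix A := by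
      ext i j
      simp [ev, Algebra.ofId_apply]
    rw [map_mul, map_mul, map_pow, hev, h2, ← map_pow, ← map_mul, ← map_mul] at h1
    have hinj : Function.Injective ((Algebra.ofId K L).mapMatrix (m := ι)) :=
      Matrix.map_injective (algebraMap K L).injective
    exact hinj h1
  have := (Matrix.mem_range_scalar_iff_commute_single'
    (M := (FreeAlgebra.lift K a p) ^ 2)).2 (fun i j => (hK _).symm)
  obtain ⟨lam, hl⟩ := this
  exact ⟨lam, by rw [← hl, Matrix.smul_one_eq_diagonal]; rfl⟩

/-- Generalised Pauli matrices. -/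
def nfcZ {L H : Type*} [Field L] [AddCommGroup H] [DecidableEq H]
    (g : H × AddChar H L) : Matrix H H L :=
  Matrix.of fun x y => if x = y + g.1 then g.2 y else 0

theorem nfcZ_mul {L H : Type*} [Field L] [AddCommGroup H] [DecidableEq H] [Fintype H]
    (g h : H × AddChar H L) : nfcZ g * nfcZ h = g.2 h.1 • nfcZ (g + h) := by
  ext x z
  simp only [nfcZ, Matrix.mul_apply, Matrix.of_apply, Matrix.smul_apply, Prod.fst_add,
    Prod.snd_add, AddChar.add_apply, smul_eq_mul]
  rw [Finset.sum_eq_single (z + h.1)]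
  · rw [if_pos rfl, show z + h.1 + g.1 = z + (g.1 + h.1) by abel, AddChar.map_add_eq_mul]
    split_ifs <;> ring
  · intro b _ hb
    rw [if_neg hb, mul_zero]
  · simp

theorem nfc_char_li (H L : Type*) [Field L] [AddCommGroup H] :
    LinearIndependent L ((⇑) : AddChar H L → H → L) :=
  (linearIndependent_monoidHom (Multiplicative H) L).comp AddChar.toMonoidHomEquiv
    AddChar.toMonoidHomEquiv.injective

theorem nfc_char_span (L H : Type*) [Field L] [CharZero L] [IsAlgClosed L] [AddCommGroup H]
    [Fintype H] [Fintype (AddChar H L)] (v : H → L) :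
    ∃ c : AddChar H L → L, ∀ x, v x = ∑ χ, c χ * χ x := by
  have hli := nfc_char_li H L
  have hcard : Fintype.card (AddChar H L) = Module.finrank L (H → L) := by
    rw [Module.finrank_fintype_fun_eq_card, ← Nat.card_eq_fintype_card, ← Nat.card_eq_fintype_card]
    have : NeZero (Monoid.exponent (Multiplicative H)) :=
      ⟨Monoid.exponent_ne_zero_of_finite⟩
    have h := CommGroup.card_monoidHom_of_hasEnoughRootsOfUnity (Multiplicative H) L
    rw [show Nat.card H = Nat.card (Multiplicative H) from rfl, ← h]
    refine Nat.card_congr (AddChar.toMonoidHomEquiv.trans ?_)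
    exact MonoidHom.toHomUnitsMulEquiv.toEquiv
  have hs := hli.span_eq_top_of_card_eq_finrank' hcard
  have hv : v ∈ Submodule.span L (Set.range ((⇑) : AddChar H L → H → L)) := by
    rw [hs]; trivial
  rw [Submodule.mem_span_range_iff_exists_fun] at hv
  obtain ⟨c, hc⟩ := hv
  exact ⟨c, fun x => by rw [← hc]; simp⟩

theorem nfc_group {K : Type*} [Field K] [CharZero K] {m : ℕ} {H : Type*}
    [Fintype H] [DecidableEq H] [AddCommGroup H]
    (j : ℕ) (hj : ∀ g : H, (4 * j) • g = 2 • g)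
    (p : FreeAlgebra K (Fin m))
    (h4 : ∀ a : Fin m → Matrix H H K, ∃ lam : K,
      (FreeAlgebra.lift K a p) ^ 4 = lam • (1 : Matrix H H K))
    (a : Fin m → Matrix H H K) :
    ∃ lam : K, (FreeAlgebra.lift K a p) ^ 2 = lam • (1 : Matrix H H K) := by
  classical
  let L := AlgebraicClosure K
  have : CharZero L := charZero_of_injective_algebraMap (algebraMap K L).injective
  have : Finite (AddChar H L) := (nfc_char_li H L).finite
  have : Fintype (AddChar H L) := Fintype.ofFinite _
  refine nfc_family (L := L) (G := H × AddChar H L) nfcZ ?_ ?_ j ?_ ?_ p h4 a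
  · intro g h
    exact ⟨_, (AddChar.val_isUnit g.2 h.1).ne_zero, nfcZ_mul g h⟩
  · ext x y
    simp [nfcZ, Matrix.one_apply]
  · rintro ⟨h, χ⟩
    refine Prod.ext (hj h) ?_
    ext x
    simp only [Prod.smul_snd, AddChar.nsmul_apply]
    rw [← AddChar.map_nsmul_eq_pow, hj, AddChar.map_nsmul_eq_pow]
  · intro A
    choose c hc using fun h : H => nfc_char_span L H (fun y => A (y + h) y)
    refine ⟨fun g => c g.1 g.2, ?_⟩
    ext x y
    rw [Matrix.sum_apply, Fintype.sum_prod_type]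
    rw [Finset.sum_eq_single (x - y)]
    · have := hc (x - y) y
      simp only [add_sub_cancel] at this
      rw [this]
      simp [nfcZ]
    · intro b _ hb
      apply Finset.sum_eq_zero
      intro χ _
      have : x ≠ y + b := by
        rintro rfl
        exact hb (by abel)
      simp [nfcZ, this]
    · simp

end Group

/-- Over a field of characteristic 0 there are no 4-central polynomials for `M_n(K)`:
if `p⁴` takes only scalar values on `M_n(K)`, then `p²` already takes only scalar
values on `M_n(K)`. -/
theorem no_four_central_polynomials
    {K : Type*} [Field K] [CharZero K] {m n : ℕ} (hn : 1 ≤ n)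
    (p : FreeAlgebra K (Fin m))
    (h4 : ∀ a : Fin m → Matrix (Fin n) (Fin n) K,
      ∃ lam : K, (ncEval p a) ^ 4 = lam • (1 : Matrix (Fin n) (Fin n) K)) :
    ∀ a : Fin m → Matrix (Fin n) (Fin n) K,
      ∃ lam : K, (ncEval p a) ^ 2 = lam • (1 : Matrix (Fin n) (Fin n) K) := by
  intro a
  obtain ⟨k, r, hr, hnr⟩ := Nat.exists_eq_two_pow_mul_odd (n := n) (by omega)
  have : NeZero r := ⟨by rintro rfl; simp at hr⟩
  let H := (Fin k → ZMod 2) × ZMod r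
  have hcard : Fintype.card (Fin n) = Fintype.card H := by
    simp [H, hnr]
  let e : Fin n ≃ H := Fintype.equivOfCardEq hcard
  let E := Matrix.reindexAlgEquiv K K e
  have hE : ∀ b : Fin m → Matrix (Fin n) (Fin n) K,
      FreeAlgebra.lift K (fun i => E (b i)) p = E (ncEval p b) := by
    intro b
    have : FreeAlgebra.lift K (fun i => E (b i)) =
        (E : Matrix (Fin n) (Fin n) K →ₐ[K] Matrix H H K).comp (FreeAlgebra.lift K b) := by
      apply FreeAlgebra.hom_ext
      funext i
      simp
    rw [this]
    rfl
  obtain ⟨t, ht⟩ := hr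
  have hj : ∀ g : H, (4 * (t + 1)) • g = 2 • g := by
    rintro ⟨u, v⟩
    have h1 : 4 * (t + 1) = 2 * r + 2 := by omega
    rw [h1, add_nsmul]
    convert zero_add _
    refine Prod.ext ?_ ?_
    · funext i
      change (2 * r) • u i = 0
      rw [nsmul_eq_mul]
      push_cast
      rw [show (2 : ZMod 2) = 0 from rfl]
      simp
    · change (2 * r) • v = 0
      simp
  obtain ⟨lam, hl⟩ := nfc_group (H := H) (t + 1) hj p (by
    intro b
    obtain ⟨lam, hl⟩ := h4 (fun i => E.symm (b i))
    refine ⟨lam, ?_⟩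
    have := hE (fun i => E.symm (b i))
    simp only [AlgEquiv.apply_symm_apply] at this
    rw [this, ← map_pow, hl, map_smul, map_one]) (fun i => E (a i))
  refine ⟨lam, E.injective ?_⟩
  rw [map_pow, ← hE, hl, map_smul, map_one]
end

section
/- Let K be a field of characteristic 0 and let p be a multilinear polynomial in m variables over K that is 2-central for M_n(K): p² takes only scalar values on M_n(K), p² does not vanish identically on M_n(K), and p does not take only scalar values on M_n(K). Then n is even and 4 does not divide n. -/
/-- The multilinear polynomial with coefficients `c : S_m → K`, evaluated at an
`m`-tuple of `n×n` matrices: `(A_1,…,A_m) ↦ Σ_{σ ∈ S_m} c_σ · A_{σ(1)} ⋯ A_{σ(m)}`. -/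
noncomputable def mlEval {K : Type*} [Field K] {m n : ℕ}
    (c : Equiv.Perm (Fin m) → K) (A : Fin m → Matrix (Fin n) (Fin n) K) :
    Matrix (Fin n) (Fin n) K :=
  ∑ σ : Equiv.Perm (Fin m), c σ • (List.ofFn fun k => A (σ k)).prod

namespace TwoCentral

/-- The evaluation over an arbitrary commutative ring. -/
noncomputable def gEval {R : Type*} [CommRing R] {m n : ℕ}
    (c : Equiv.Perm (Fin m) → R) (A : Fin m → Matrix (Fin n) (Fin n) R) :
    Matrix (Fin n) (Fin n) R :=
  ∑ σ : Equiv.Perm (Fin m), c σ • (List.ofFn fun k => A (σ k)).prod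

lemma gEval_map {R S : Type*} [CommRing R] [CommRing S] (f : R →+* S) {m n : ℕ}
    (c : Equiv.Perm (Fin m) → R) (A : Fin m → Matrix (Fin n) (Fin n) R) :
    f.mapMatrix (gEval c A) = gEval (fun σ => f (c σ)) (fun k => f.mapMatrix (A k)) := by
  unfold gEval
  rw [map_sum]
  refine Finset.sum_congr rfl fun σ _ => ?_
  have h : f.mapMatrix (List.ofFn fun k => A (σ k)).prod
      = (List.ofFn fun k => f.mapMatrix (A (σ k))).prod := by
    rw [map_list_prod, List.map_ofFn]; rfl
  rw [← h]
  ext i j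
  simp

lemma gEval_conj {R : Type*} [CommRing R] {m n : ℕ}
    (c : Equiv.Perm (Fin m) → R) (A : Fin m → Matrix (Fin n) (Fin n) R)
    (U V : Matrix (Fin n) (Fin n) R) (hUV : U * V = 1) (hVU : V * U = 1) :
    gEval c (fun k => U * A k * V) = U * gEval c A * V := by
  unfold gEval
  rw [Finset.mul_sum, Finset.sum_mul]
  refine Finset.sum_congr rfl fun σ _ => ?_
  rw [Matrix.mul_smul, Matrix.smul_mul]
  congr 1
  let φ : Matrix (Fin n) (Fin n) R →* Matrix (Fin n) (Fin n) R :=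
    { toFun := fun B => U * B * V
      map_one' := by simp [hUV]
      map_mul' := fun B C => by
        calc U * (B * C) * V = U * B * 1 * (C * V) := by simp only [mul_assoc, mul_one]
          _ = U * B * (V * U) * (C * V) := by rw [hVU]
          _ = _ := by simp only [mul_assoc] }
  have := map_list_prod φ (List.ofFn fun k => A (σ k))
  rw [List.map_ofFn] at this
  exact this.symm

/-- The square-scalar hypothesis extends to all algebras over an infinite field. -/
lemma extend_sq {K L : Type*} [Field K] [Infinite K] [CommRing L] [Algebra K L] {m n : ℕ}
    (c : Equiv.Perm (Fin m) → K)
    (hsq : ∀ A : Fin m → Matrix (Fin n) (Fin n) K,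
      ∃ lam : K, (gEval c A) ^ 2 = lam • (1 : Matrix (Fin n) (Fin n) K))
    (A : Fin m → Matrix (Fin n) (Fin n) L) (i j : Fin n) (hij : i ≠ j) :
    ((gEval (fun σ => algebraMap K L (c σ)) A) ^ 2) i j = 0 := by
  let G : Fin m → Matrix (Fin n) (Fin n) (MvPolynomial (Fin m × Fin n × Fin n) K) :=
    fun k => Matrix.of fun i j => MvPolynomial.X (k, i, j)
  let P := (gEval (fun σ => MvPolynomial.C (c σ)) G) ^ 2
  have key : P i j = 0 := by
    apply MvPolynomial.funext
    intro x
    have h1 := gEval_map (MvPolynomial.eval x) (fun σ => MvPolynomial.C (c σ)) G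
    have h2 : (MvPolynomial.eval x).mapMatrix P =
      (gEval c (fun k => Matrix.of fun i j => x (k, i, j))) ^ 2 := by
      simp only [P, map_pow]
      rw [h1]
      congr 2
      · funext σ; simp
      · funext k; ext a b; simp [G]
    obtain ⟨lam, hl⟩ := hsq (fun k => Matrix.of fun i j => x (k, i, j))
    rw [hl] at h2
    have := congrFun (congrFun h2 i) j
    simpa [Matrix.one_apply, hij] using this
  let x : Fin m × Fin n × Fin n → L := fun t => A t.1 t.2.1 t.2.2
  have h1 := gEval_map ((MvPolynomial.aeval x).toRingHom : MvPolynomial _ K →+* L)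
    (fun σ => MvPolynomial.C (c σ)) G
  have h2 : ((MvPolynomial.aeval x).toRingHom : MvPolynomial _ K →+* L).mapMatrix P =
      (gEval (fun σ => algebraMap K L (c σ)) A) ^ 2 := by
    simp only [P, map_pow]
    rw [h1]
    congr 2
    · funext σ; simp [MvPolynomial.algebraMap_eq]
    · funext k; ext a b; simp [G, x]
  rw [← h2]
  simp [key]

/-- The multilinear map attached to `c`. -/
noncomputable def gMul {R : Type*} [CommRing R] {m : ℕ} (n : ℕ)
    (c : Equiv.Perm (Fin m) → R) :
    MultilinearMap R (fun _ : Fin m => Matrix (Fin n) (Fin n) R) (Matrix (Fin n) (Fin n) R) :=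
  ∑ σ : Equiv.Perm (Fin m), c σ •
    (MultilinearMap.mkPiAlgebraFin R m (Matrix (Fin n) (Fin n) R)).domDomCongr σ

lemma gMul_apply {R : Type*} [CommRing R] {m n : ℕ}
    (c : Equiv.Perm (Fin m) → R) (A : Fin m → Matrix (Fin n) (Fin n) R) :
    gMul n c A = gEval c A := by
  simp [gMul, gEval, MultilinearMap.sum_apply]

section Weyl

variable {L : Type*} [Field L] {n : ℕ} [NeZero n]

/-- Weyl (clock and shift) monomials. -/
def W (ζ : L) (a : Fin n) (b : ℕ) : Matrix (Fin n) (Fin n) L :=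
  Matrix.of fun i j => if i = j + a then (ζ ^ j.val) ^ b else 0

lemma chi_add {ζ : L} (hζ : ζ ^ n = 1) (i j : Fin n) :
    ζ ^ (i + j).val = ζ ^ i.val * ζ ^ j.val := by
  rw [← pow_add, Fin.val_add]
  exact (pow_eq_pow_mod _ hζ).symm

lemma W_mul {ζ : L} (hζ : ζ ^ n = 1) (a a' : Fin n) (b b' : ℕ) :
    W ζ a b * W ζ a' b' = (ζ ^ a'.val) ^ b • W ζ (a + a') (b + b') := by
  ext i j
  rw [Matrix.mul_apply, Finset.sum_eq_single (j + a')]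
  · simp only [W, Matrix.of_apply, Matrix.smul_apply, smul_eq_mul, if_true,
      chi_add hζ, mul_pow, pow_add]
    rw [show j + a' + a = j + (a + a') by rw [add_assoc, add_comm a' a]]
    split_ifs <;> ring
  · intro k _ hk
    simp [W, hk]
  · simp

lemma W_zero (ζ : L) : W ζ (0 : Fin n) 0 = 1 := by
  ext i j
  simp [W, Matrix.one_apply]

lemma W_prod {ζ : L} (hζ : ζ ^ n = 1) (l : List (Fin n × ℕ)) :
    ∃ t : L, (l.map fun p => W ζ p.1 p.2).prod
      = t • W ζ (l.map Prod.fst).sum (l.map Prod.snd).sum := by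
  induction l with
  | nil => exact ⟨1, by simp [W_zero]⟩
  | cons p l ih =>
    obtain ⟨t, ht⟩ := ih
    refine ⟨t * (ζ ^ (l.map Prod.fst).sum.val) ^ p.2, ?_⟩
    simp only [List.map_cons, List.prod_cons, List.sum_cons]
    rw [ht, Matrix.mul_smul, W_mul hζ, smul_smul]

lemma gEval_W {ζ : L} (hζ : ζ ^ n = 1) {m : ℕ} (c : Equiv.Perm (Fin m) → L)
    (a : Fin m → Fin n) (b : Fin m → ℕ) :
    ∃ t : L, gEval c (fun k => W ζ (a k) (b k)) = t • W ζ (∑ k, a k) (∑ k, b k) := by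
  have h : ∀ σ : Equiv.Perm (Fin m), ∃ t : L,
      (List.ofFn fun k => W ζ (a (σ k)) (b (σ k))).prod = t • W ζ (∑ k, a k) (∑ k, b k) := by
    intro σ
    obtain ⟨t, ht⟩ := W_prod hζ (List.ofFn fun k => (a (σ k), b (σ k)))
    refine ⟨t, ?_⟩
    simp only [List.map_ofFn, List.sum_ofFn, Function.comp_def] at ht
    rw [Equiv.sum_comp σ a, Equiv.sum_comp σ b] at ht
    exact ht
  choose t ht using h
  refine ⟨∑ σ, c σ * t σ, ?_⟩
  unfold gEval
  simp only [ht, smul_smul, Finset.sum_smul]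

lemma W_decomp [CharZero L] {ζ : L} (hζ : IsPrimitiveRoot ζ n) (A : Matrix (Fin n) (Fin n) L) :
    ∃ t : Fin n × Fin n → L, A = ∑ p, t p • W ζ p.1 p.2.val := by
  have hn : (n : L) ≠ 0 := Nat.cast_ne_zero.mpr (NeZero.ne n)
  have hz : ζ ≠ 0 := hζ.ne_zero (NeZero.ne n)
  refine ⟨fun p => ∑ j, A (j + p.1) j * (n : L)⁻¹ * ((ζ ^ j.val)⁻¹) ^ p.2.val, ?_⟩
  ext k l
  have hsum : ∀ j : Fin n, ∑ b : Fin n, ((ζ ^ j.val)⁻¹) ^ b.val * (ζ ^ l.val) ^ b.val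
      = if j = l then (n : L) else 0 := by
    intro j
    simp only [← mul_pow]
    rw [Fin.sum_univ_eq_sum_range (fun b => ((ζ ^ j.val)⁻¹ * ζ ^ l.val) ^ b) n]
    split_ifs with h
    · subst h
      rw [inv_mul_cancel₀ (pow_ne_zero _ hz)]; simp
    · have h1 : ((ζ ^ j.val)⁻¹ * ζ ^ l.val) ≠ 1 := by
        intro h1
        apply h
        rw [inv_mul_eq_one₀ (pow_ne_zero _ hz)] at h1
        exact Fin.ext (hζ.pow_inj j.2 l.2 h1)
      have h2 : ((ζ ^ j.val)⁻¹ * ζ ^ l.val) ^ n = 1 := by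
        rw [mul_pow, inv_pow, ← pow_mul, ← pow_mul, mul_comm _ n, mul_comm _ n, pow_mul, pow_mul,
          hζ.pow_eq_one]
        simp
      have h3 := mul_geom_sum ((ζ ^ j.val)⁻¹ * ζ ^ l.val) n
      rw [h2, sub_self] at h3
      exact (mul_eq_zero.mp h3).resolve_left (sub_ne_zero.mpr h1)
  rw [Matrix.sum_apply, Fintype.sum_prod_type, Finset.sum_eq_single (k - l)]
  · simp only [W, Matrix.smul_apply, Matrix.of_apply, smul_eq_mul, add_sub_cancel, if_true,
      Finset.sum_mul]
    rw [Finset.sum_comm]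
    simp only [mul_assoc, ← Finset.mul_sum, hsum]
    simp [hn]
  · intro a _ ha
    refine Finset.sum_eq_zero fun b _ => ?_
    have : k ≠ l + a := by rintro rfl; simp at ha
    simp [W, this]
  · simp

/-- Every value commutes with the square of the clock matrix. -/
lemma commute_clock [CharZero L] {ζ : L} (hζ : IsPrimitiveRoot ζ n) {m : ℕ}
    (c : Equiv.Perm (Fin m) → L)
    (hsq : ∀ (A : Fin m → Matrix (Fin n) (Fin n) L) (i j : Fin n), i ≠ j →
      ((gEval c A) ^ 2) i j = 0) (A : Fin m → Matrix (Fin n) (Fin n) L) :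
    Commute (W ζ 0 2) (gEval c A) := by
  have hz : ζ ≠ 0 := hζ.ne_zero (NeZero.ne n)
  have h1 := hζ.pow_eq_one
  have hW : ∀ (a : Fin m → Fin n) (b : Fin m → ℕ),
      Commute (W ζ 0 2) (gEval c (fun k => W ζ (a k) (b k))) := by
    intro a b
    obtain ⟨t, ht⟩ := gEval_W h1 c a b
    have hs := hsq (fun k => W ζ (a k) (b k))
    rw [ht] at hs ⊢
    generalize (∑ k, a k) = a at *
    generalize (∑ k, b k) = b at *
    by_cases ht0 : t = 0
    · subst ht0; simp
    have haa : a + a = 0 := by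
      by_contra hne
      have := hs (a + a) 0 hne
      rw [sq, Matrix.smul_mul, Matrix.mul_smul, W_mul h1] at this
      simp [W, ht0, hz] at this
    apply Commute.smul_right
    unfold Commute SemiconjBy
    rw [W_mul h1, W_mul h1]
    have : (ζ ^ a.val) ^ 2 = 1 := by
      rw [sq, ← chi_add h1, haa]; simp
    rw [this]
    simp [add_comm]
  choose t ht using fun k => W_decomp hζ (A k)
  have hA : A = fun k => ∑ p, t k p • W ζ p.1 p.2.val := funext ht
  rw [← gMul_apply, hA, MultilinearMap.map_sum]
  refine Commute.sum_right _ _ _ fun r _ => ?_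
  have := (gMul n c).map_smul_univ (fun k => t k (r k)) (fun k => W ζ (r k).1 (r k).2.val)
  rw [this]
  apply Commute.smul_right
  rw [gMul_apply]
  exact hW _ _

end Weyl

lemma commute_single {L : Type*} [Field L] {n m : ℕ} (c : Equiv.Perm (Fin m) → L)
    (d : Fin n → L)
    (h : ∀ A : Fin m → Matrix (Fin n) (Fin n) L, Commute (Matrix.diagonal d) (gEval c A))
    (A : Fin m → Matrix (Fin n) (Fin n) L) (i j : Fin n) (hij : d i ≠ d j) :
    Commute (Matrix.single i j (1 : L)) (gEval c A) := by
  have hne : i ≠ j := fun h => hij (by rw [h])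
  set E : Matrix (Fin n) (Fin n) L := Matrix.single i j (1 : L) with hE
  set D := Matrix.diagonal d
  have hEE : E * E = 0 := by
    rw [hE, Matrix.single_mul_single_of_ne]; exact hne.symm
  have hED : E * D = d j • E := by
    ext a b
    simp only [D, Matrix.mul_diagonal, Matrix.smul_apply, hE, Matrix.single_apply, smul_eq_mul]
    split_ifs with hh
    · rw [hh.2]; ring
    · simp
  have hDE : D * E = d i • E := by
    ext a b
    simp only [D, Matrix.diagonal_mul, Matrix.smul_apply, hE, Matrix.single_apply, smul_eq_mul]
    split_ifs with hh
    · rw [hh.1]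
    · simp
  have h0 := h A
  have h1 := h (fun k => (1 - E) * A k * (1 + E))
  have e1 : (1 - E) * (1 + E) = 1 := by
    simp [sub_mul, mul_add, hEE]
  have e2 : (1 + E) * (1 - E) = 1 := by
    simp [add_mul, mul_sub, hEE]
  rw [gEval_conj c A _ _ e1 e2] at h1
  generalize gEval c A = B at *
  -- conjugate the commutation back
  have h2 : Commute ((1 + E) * D * (1 - E)) B := by
    unfold Commute SemiconjBy at h1 ⊢
    have h3 : (1 + E) * (D * ((1 - E) * B * (1 + E))) * (1 - E)
        = (1 + E) * ((1 - E) * B * (1 + E) * D) * (1 - E) := by rw [h1]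
    calc (1 + E) * D * (1 - E) * B
        = (1 + E) * D * (1 - E) * B * ((1 + E) * (1 - E)) := by rw [e2, mul_one]
      _ = (1 + E) * (D * ((1 - E) * B * (1 + E))) * (1 - E) := by simp only [mul_assoc]
      _ = _ := h3
      _ = ((1 + E) * (1 - E)) * (B * ((1 + E) * D * (1 - E))) := by simp only [mul_assoc]
      _ = _ := by rw [e2, one_mul]
  have h3 : (1 + E) * D * (1 - E) = D + (d j - d i) • E := by
    simp only [add_mul, mul_sub, one_mul, mul_one, hED, hDE, Matrix.smul_mul, hEE, smul_zero,
      sub_zero, sub_smul]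
    abel
  rw [h3] at h2
  have h4 : Commute ((d j - d i) • E) B := by
    have := h2.sub_left h0
    simpa using this
  have h5 := h4.smul_left (d j - d i)⁻¹
  rwa [smul_smul, inv_mul_cancel₀ (sub_ne_zero.mpr hij.symm), one_smul] at h5

end TwoCentral

/-- If `char K = 0` and `p` is a multilinear polynomial that is 2-central for `M_n(K)`
(`p²` takes only scalar values, `p²` does not vanish identically, and `p` does not take
only scalar values), then `n` is even and `4 ∤ n`. -/
theorem two_central_multilinear_even_not_four_dvd
    {K : Type*} [Field K] [CharZero K] {m n : ℕ}
    (c : Equiv.Perm (Fin m) → K)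
    (hsq : ∀ A : Fin m → Matrix (Fin n) (Fin n) K,
      ∃ lam : K, (mlEval c A) ^ 2 = lam • (1 : Matrix (Fin n) (Fin n) K))
    (hnz : ∃ A : Fin m → Matrix (Fin n) (Fin n) K, (mlEval c A) ^ 2 ≠ 0)
    (hns : ∃ A : Fin m → Matrix (Fin n) (Fin n) K,
      ∀ lam : K, mlEval c A ≠ lam • (1 : Matrix (Fin n) (Fin n) K)) :
    Even n ∧ ¬ (4 ∣ n) := by
  classical
  have hn3 : ¬ 3 ≤ n := by
    intro h3
    haveI : NeZero n := ⟨by omega⟩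
    let L := AlgebraicClosure K
    haveI : CharZero L := charZero_of_injective_algebraMap (algebraMap K L).injective
    haveI : NeZero (n : L) := ⟨Nat.cast_ne_zero.mpr (NeZero.ne n)⟩
    obtain ⟨ζ, hζ⟩ := HasEnoughRootsOfUnity.exists_primitiveRoot L n
    obtain ⟨A, hA⟩ := hns
    have hcomm := TwoCentral.commute_clock hζ (fun σ => algebraMap K L (c σ))
      (fun B i j hij => TwoCentral.extend_sq c hsq B i j hij)
    have hW : TwoCentral.W ζ (0 : Fin n) 2 = Matrix.diagonal fun i => (ζ ^ i.val) ^ 2 := by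
      ext i j
      simp only [TwoCentral.W, Matrix.of_apply, add_zero, Matrix.diagonal_apply]
      split_ifs with h
      · rw [h]
      · rfl
    rw [hW] at hcomm
    have hζ2 : ζ ^ 2 ≠ 1 := fun h => by
      have := Nat.le_of_dvd (by norm_num) (hζ.dvd_of_pow_eq_one 2 h)
      omega
    have hz : ζ ≠ 0 := hζ.ne_zero (NeZero.ne n)
    have hd : ∀ i : Fin n, (ζ ^ i.val) ^ 2 ≠ (ζ ^ (i + 1).val) ^ 2 := by
      intro i h
      rw [TwoCentral.chi_add hζ.pow_eq_one, mul_pow] at h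
      have h1 : (1 : Fin n).val = 1 := by
        rw [Fin.val_one']; exact Nat.mod_eq_of_lt (by omega)
      rw [h1, pow_one] at h
      exact hζ2 (mul_left_cancel₀ (pow_ne_zero 2 (pow_ne_zero i.val hz)) (by rw [← h, mul_one]))
    have hs := fun i => TwoCentral.commute_single _ _ hcomm
      (fun k => (algebraMap K L).mapMatrix (A k)) i (i + 1) (hd i)
    have hmap := TwoCentral.gEval_map (algebraMap K L) c A
    rw [← hmap] at hs
    have hent : ∀ i k l : Fin n, (Matrix.single i (i + 1) (1 : L) *
        (algebraMap K L).mapMatrix (TwoCentral.gEval c A)) k l =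
        ((algebraMap K L).mapMatrix (TwoCentral.gEval c A) *
          Matrix.single i (i + 1) (1 : L)) k l := fun i k l => by rw [(hs i).eq]
    have hne : ∀ i : Fin n, i + 1 ≠ i := fun i h => hd i (by rw [h])
    have hoff : ∀ k i : Fin n, k ≠ i → TwoCentral.gEval c A k i = 0 := by
      intro k i hki
      have := hent i k (i + 1)
      rw [Matrix.single_mul_apply_of_ne _ _ _ _ _ hki, Matrix.mul_single_apply_same] at this
      simpa using this.symm
    have hdiag : ∀ i : Fin n, TwoCentral.gEval c A (i + 1) (i + 1) = TwoCentral.gEval c A i i := by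
      intro i
      have := hent i i (i + 1)
      rw [Matrix.single_mul_apply_same, Matrix.mul_single_apply_same] at this
      simpa using this
    have hall : ∀ (k : ℕ) (hk : k < n),
        TwoCentral.gEval c A ⟨k, hk⟩ ⟨k, hk⟩ = TwoCentral.gEval c A 0 0 := by
      intro k
      induction k with
      | zero => intro hk; rfl
      | succ k ih =>
        intro hk
        have hk' : k < n := by omega
        rw [← ih hk', ← hdiag ⟨k, hk'⟩]
        have : (⟨k, hk'⟩ : Fin n) + 1 = ⟨k + 1, hk⟩ := by
          apply Fin.ext
          rw [Fin.val_add, Fin.val_one', Nat.mod_eq_of_lt (show 1 < n by omega)]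
          exact Nat.mod_eq_of_lt hk
        rw [this]
    refine hA (TwoCentral.gEval c A 0 0) ?_
    change TwoCentral.gEval c A = _
    ext i j
    by_cases hij : i = j
    · subst hij
      simpa using hall i.val i.2
    · simp [hoff i j hij, Matrix.one_apply, hij]
  obtain ⟨A, hA⟩ := hns
  have h2 : n = 2 := by
    by_contra hn2
    have h01 : n = 0 ∨ n = 1 := by omega
    rcases h01 with rfl | rfl
    · exact hA 0 (Subsingleton.elim _ _)
    · refine hA (mlEval c A 0 0) ?_
      ext i j
      rw [Subsingleton.elim i 0, Subsingleton.elim j 0]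
      simp
  subst h2
  exact ⟨even_two, by norm_num⟩
end

section
/- Let K be an infinite field, let ν ≥ 1 with char K not dividing ν, and suppose ν is relatively prime to n. If p is a polynomial in m noncommuting variables over K such that p^ν takes only scalar values on M_n(K), then p itself takes only scalar values on M_n(K). In particular, if p is ν-central for M_n(K) with ν > 1, then ν cannot be relatively prime to n. -/
open Polynomial in
/-- Polynomials in `w` whose exponents are all congruent to `d` mod `n`. -/
def gradedPart (n : ℕ) (S : Type*) [CommRing S] (d : ZMod n) : AddSubgroup S[X] where
  carrier := {f | ∀ k, f.coeff k ≠ 0 → (k : ZMod n) = d}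
  zero_mem' := by intro k hk; simp at hk
  add_mem' := by
    intro a b ha hb k hk
    by_cases h : a.coeff k = 0
    · exact hb k (by intro h'; apply hk; simp [h, h'])
    · exact ha k h
  neg_mem' := by
    intro a ha k hk
    exact ha k (by simpa using hk)

open Polynomial in
lemma gradedPart_mul {n : ℕ} {S : Type*} [CommRing S] {d e : ZMod n} {f g : S[X]}
    (hf : f ∈ gradedPart n S d) (hg : g ∈ gradedPart n S e) :
    f * g ∈ gradedPart n S (d + e) := by
  intro k hk
  rw [coeff_mul] at hk
  obtain ⟨x, hx, hne⟩ := Finset.exists_ne_zero_of_sum_ne_zero hk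
  replace hx : x.1 + x.2 = k := Finset.HasAntidiagonal.mem_antidiagonal.1 hx
  rw [← hx, Nat.cast_add, hf _ (left_ne_zero_of_mul hne), hg _ (right_ne_zero_of_mul hne)]

open Polynomial in
lemma gradedPart_C {n : ℕ} {S : Type*} [CommRing S] (s : S) :
    C s ∈ gradedPart n S 0 := by
  intro k hk
  rw [coeff_C] at hk
  by_cases h : k = 0
  · simp [h]
  · simp [h] at hk

open Polynomial in
lemma gradedPart_prod {n : ℕ} {S ι : Type*} [CommRing S] (s : Finset ι) (d : ι → ZMod n)
    (f : ι → S[X]) (hf : ∀ i, f i ∈ gradedPart n S (d i)) :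
    ∏ i ∈ s, f i ∈ gradedPart n S (∑ i ∈ s, d i) := by
  classical
  induction s using Finset.induction_on with
  | empty => simpa using gradedPart_C (n := n) (1 : S)
  | insert a s ha ih =>
    rw [Finset.prod_insert ha, Finset.sum_insert ha]
    exact gradedPart_mul (hf a) ih

open Polynomial in
/-- The domain `A` of matrices over `S[w]`, for an automorphism `σ` of `S`. -/
def twistedAlg (n : ℕ) [NeZero n] (B S : Type*) [CommRing B] [CommRing S] [Algebra B S]
    (σ : S →ₐ[B] S) : Subalgebra B (Matrix (ZMod n) (ZMod n) S[X]) where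
  carrier := {M | (∀ i j, M i j ∈ gradedPart n S (j - i)) ∧
    ∀ i j, M (i + 1) (j + 1) = mapRingHom (σ : S →+* S) (M i j)}
  mul_mem' := by
    rintro M N ⟨hM, hM'⟩ ⟨hN, hN'⟩
    refine ⟨fun i j => ?_, fun i j => ?_⟩
    · rw [Matrix.mul_apply]
      refine sum_mem fun l _ => ?_
      have := gradedPart_mul (hM i l) (hN l j)
      rwa [show l - i + (j - l) = j - i by ring] at this
    · rw [Matrix.mul_apply, Matrix.mul_apply, map_sum,
        ← Equiv.sum_comp (Equiv.addRight (1 : ZMod n))]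
      refine Finset.sum_congr rfl fun l _ => ?_
      simp only [Equiv.coe_addRight, hM', hN', map_mul]
  add_mem' := by
    rintro M N ⟨hM, hM'⟩ ⟨hN, hN'⟩
    refine ⟨fun i j => add_mem (hM i j) (hN i j), fun i j => ?_⟩
    rw [Matrix.add_apply, Matrix.add_apply, hM', hN', map_add]
  algebraMap_mem' := by
    intro b
    refine ⟨fun i j => ?_, fun i j => ?_⟩
    · rw [Matrix.algebraMap_matrix_apply]
      split_ifs with h
      · rw [h, sub_self]
        exact gradedPart_C _
      · exact zero_mem _
    · rw [Matrix.algebraMap_matrix_apply, Matrix.algebraMap_matrix_apply]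
      by_cases h : i = j
      · simp [h, Polynomial.algebraMap_apply]
      · simp [h]

open Polynomial in
lemma twistedAlg_det {n : ℕ} [NeZero n] {B S : Type*} [CommRing B] [CommRing S] [Algebra B S]
    {σ : S →ₐ[B] S} {M : Matrix (ZMod n) (ZMod n) S[X]} (hM : M ∈ twistedAlg n B S σ) :
    M.det • (1 : Matrix (ZMod n) (ZMod n) S[X]) ∈ twistedAlg n B S σ := by
  obtain ⟨h1, h2⟩ := hM
  have hd : M.det ∈ gradedPart n S 0 := by
    rw [Matrix.det_apply]
    refine sum_mem fun π _ => ?_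
    have := gradedPart_prod Finset.univ (fun i => i - π i) (fun i => M (π i) i)
      (fun i => h1 _ _)
    rw [Finset.sum_sub_distrib, Equiv.sum_comp π (fun i => i), sub_self] at this
    rcases Int.units_eq_one_or (Equiv.Perm.sign π) with h | h
    · rw [h, one_smul]; exact this
    · rw [h, Units.neg_smul, one_smul]; exact neg_mem this
  have hs : mapRingHom (σ : S →+* S) M.det = M.det := by
    rw [RingHom.map_det]
    rw [← Matrix.det_submatrix_equiv_self (Equiv.addRight (1 : ZMod n)) M]
    congr 1
    ext1 i j
    exact (h2 i j).symm
  refine ⟨fun i j => ?_, fun i j => ?_⟩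
  · rw [Matrix.smul_apply, Matrix.one_apply]
    split_ifs with h
    · rw [h, sub_self, smul_eq_mul, mul_one]; exact hd
    · rw [smul_zero]; exact zero_mem _
  · rw [Matrix.smul_apply, Matrix.smul_apply, Matrix.one_apply, Matrix.one_apply]
    by_cases h : i = j
    · simp only [h, if_true, smul_eq_mul, mul_one, hs]
    · simp [h]

open Polynomial in
lemma twistedAlg_eq_zero {n : ℕ} [NeZero n] {B S : Type*} [CommRing B] [CommRing S] [IsDomain S]
    [Algebra B S] {σ : S →ₐ[B] S} (hσ : Function.Injective σ)
    {M : Matrix (ZMod n) (ZMod n) S[X]} (hM : M ∈ twistedAlg n B S σ) (hdet : M.det = 0) :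
    M = 0 := by
  classical
  obtain ⟨h1, h2⟩ := hM
  by_contra hne
  have hex : ∃ k, ∃ i j, (M i j).coeff k ≠ 0 := by
    by_contra! hc
    apply hne
    ext i j k
    simpa using hc k i j
  obtain ⟨i0, j0, h0⟩ := Nat.find_spec hex
  have hmin : ∀ l < Nat.find hex, ∀ i j, (M i j).coeff l = 0 := by
    intro l hl
    have := Nat.find_min hex hl
    push Not at this
    exact this
  generalize Nat.find hex = k at h0 hmin
  have hdiv : ∀ i j, ∃ q : S[X], M i j = X ^ k * q := fun i j =>
    X_pow_dvd_iff.2 fun d hd => hmin d hd i j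
  choose N hN using hdiv
  have hMN : M = (X ^ k : S[X]) • (Matrix.of N) := by
    ext1 i j
    rw [hN]; rfl
  have hdN : (Matrix.of N).det = 0 := by
    rw [hMN, Matrix.det_smul] at hdet
    exact (mul_eq_zero.1 hdet).resolve_left (pow_ne_zero _ (pow_ne_zero _ X_ne_zero))
  have hc : ∀ i j, (N i j).coeff 0 = (M i j).coeff k := by
    intro i j
    rw [hN, coeff_X_pow_mul']
    simp
  let N0 : Matrix (ZMod n) (ZMod n) S := fun i j => (M i j).coeff k
  have hN0 : N0.det = 0 := by
    have := congrArg (constantCoeff (R := S)) hdN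
    rw [RingHom.map_det, map_zero] at this
    rw [← this]
    congr 1
    ext1 i j
    exact (hc i j).symm
  have hj0 : (k : ZMod n) = j0 - i0 := h1 i0 j0 k h0
  have hshift : ∀ l : ℕ, N0 (i0 + l) (j0 + l) ≠ 0 := by
    intro l
    induction l with
    | zero => simpa using h0
    | succ l ih =>
      have e : N0 (i0 + (l + 1 : ℕ)) (j0 + (l + 1 : ℕ)) = σ (N0 (i0 + l) (j0 + l)) := by
        simp only [N0]
        push_cast
        rw [← add_assoc, ← add_assoc, h2]
        simp
      rw [e]
      exact fun h => ih (hσ (by rw [h, map_zero]))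
  have hall : ∀ i, N0 i (i + k) ≠ 0 := by
    intro i
    have := hshift (i - i0).val
    rw [ZMod.natCast_zmod_val] at this
    rw [hj0]
    convert this using 2 <;> ring
  have hdiag : N0.submatrix id (Equiv.addRight (k : ZMod n)) =
      Matrix.diagonal fun i => N0 i (i + k) := by
    ext1 i j
    by_cases h : i = j
    · subst h; simp
    · rw [Matrix.diagonal_apply_ne _ h]
      by_contra hcon
      have : (k : ZMod n) = (j + k) - i := h1 i (j + k) k hcon
      apply h
      linear_combination this
  have hd := Matrix.det_permute' (Equiv.addRight (k : ZMod n)) N0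
  rw [hN0, mul_zero, hdiag, Matrix.det_diagonal] at hd
  exact Finset.prod_ne_zero_iff.2 (fun i _ => hall i) hd

open Polynomial in
/-- The key step inside the twisted algebra. -/
lemma twistedAlg_scalar {n ν : ℕ} [NeZero n] {B S : Type*} [Field B] [IsAlgClosed B]
    [CommRing S] [IsDomain S] [Algebra B S] {σ : S →ₐ[B] S} (hσ : Function.Injective σ)
    (hν : 1 ≤ ν) (hchar : (ν : B) ≠ 0) (hcop : Nat.Coprime ν n)
    {g : Matrix (ZMod n) (ZMod n) S[X]} (hg : g ∈ twistedAlg n B S σ) (c : S[X])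
    (hc : g ^ ν = c • 1) : ∃ r : S[X], g = r • 1 := by
  classical
  have hdet : g.det ^ ν = c ^ n := by
    rw [← Matrix.det_pow, hc, Matrix.det_smul, Matrix.det_one, mul_one, ZMod.card]
  by_cases hc0 : c = 0
  · refine ⟨0, ?_⟩
    rw [zero_smul]
    apply twistedAlg_eq_zero hσ hg
    rw [hc0, zero_pow (NeZero.ne n)] at hdet
    exact pow_eq_zero_iff (by omega) |>.1 hdet
  -- roots of unity
  have hNZ : NeZero (ν : B) := ⟨hchar⟩
  have hNZ' : NeZero ν := ⟨by omega⟩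
  obtain ⟨ζ, hζ⟩ := HasEnoughRootsOfUnity.exists_primitiveRoot B ν
  have hinj : Function.Injective (algebraMap B S[X][X]) := (algebraMap B S[X][X]).injective
  have hζ' : IsPrimitiveRoot (algebraMap B S[X][X] ζ) ν := hζ.map_of_injective hinj
  have hprod := hζ'.pow_sub_pow_eq_prod_sub_mul (X : S[X][X]) (C g.det) (by omega)
  have h1 : Matrix.detMonoidHom (aeval (g ^ n) ((X : S[X][X]) ^ ν - C g.det ^ ν)) = 0 := by
    have : aeval (g ^ n) ((X : S[X][X]) ^ ν - C g.det ^ ν) = 0 := by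
      rw [map_sub, map_pow, map_pow, aeval_X, aeval_C, ← map_pow, hdet, ← pow_mul, mul_comm n ν,
        pow_mul, hc, _root_.smul_pow, one_pow, Algebra.algebraMap_eq_smul_one, sub_self]
    rw [this]
    exact Matrix.det_zero
  rw [hprod] at h1
  let F : S[X][X] →* S[X] :=
    (Matrix.detMonoidHom (n := ZMod n) (R := S[X])).comp
      ((aeval (R := S[X]) (g ^ n)) : S[X][X] →* Matrix (ZMod n) (ZMod n) S[X])
  have h2 : F (∏ ω ∈ nthRootsFinset ν (1 : S[X][X]), (X - ω * C g.det)) = 0 := h1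
  rw [map_prod, Finset.prod_eq_zero_iff] at h2
  obtain ⟨ω, hω, h3⟩ := h2
  rw [mem_nthRootsFinset (by omega)] at hω
  obtain ⟨i, -, hi⟩ := hζ'.eq_pow_of_pow_eq_one hω
  rw [← map_pow] at hi
  have h4 : aeval (g ^ n) (X - ω * C g.det) =
      g ^ n - (ζ ^ i) • (g.det • (1 : Matrix (ZMod n) (ZMod n) S[X])) := by
    rw [← hi, map_sub, map_mul, aeval_X, aeval_C, IsScalarTower.algebraMap_apply B S[X] S[X][X],
      Polynomial.algebraMap_apply (R := S[X]), Algebra.algebraMap_self, RingHom.id_apply, aeval_C,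
      ← IsScalarTower.algebraMap_apply, ← Algebra.smul_def, Algebra.algebraMap_eq_smul_one]
  have h5 : g ^ n - (ζ ^ i) • (g.det • (1 : Matrix (ZMod n) (ZMod n) S[X])) = 0 := by
    apply twistedAlg_eq_zero hσ (sub_mem (pow_mem hg n)
      (Subalgebra.smul_mem _ (twistedAlg_det hg) _))
    rw [← h4]
    exact h3
  have h6 : g ^ n = ((ζ ^ i) • g.det) • (1 : Matrix (ZMod n) (ZMod n) S[X]) := by
    rw [sub_eq_zero.1 h5, smul_assoc]
  generalize (ζ ^ i) • g.det = e at h6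
  rcases Nat.eq_or_lt_of_le hν with h | h
  · exact ⟨c, by rw [← hc, ← h, pow_one]⟩
  obtain ⟨a, ha⟩ := Nat.exists_mul_mod_eq_one_of_coprime hcop.symm h
  replace ha : n * a = ν * (n * a / ν) + 1 := by
    have := Nat.div_add_mod (n * a) ν
    omega
  generalize n * a / ν = b at ha
  have h7 : c ^ b • g = e ^ a • (1 : Matrix (ZMod n) (ZMod n) S[X]) := by
    have : g ^ (n * a) = g ^ (ν * b + 1) := by rw [ha]
    rw [pow_mul, h6, _root_.smul_pow, one_pow, pow_succ, pow_mul, hc, _root_.smul_pow, one_pow, smul_mul_assoc,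
      one_mul] at this
    exact this.symm
  have hcb : c ^ b ≠ 0 := pow_ne_zero _ hc0
  have h8 : ∀ i j, c ^ b * g i j = if i = j then e ^ a else 0 := by
    intro i j
    have := congrFun (congrFun h7 i) j
    simpa [Matrix.one_apply] using this
  refine ⟨g 0 0, ?_⟩
  ext1 i j
  apply mul_left_cancel₀ hcb
  rw [h8, Matrix.smul_apply, Matrix.one_apply]
  split_ifs
  · rw [smul_eq_mul, mul_one, h8]; simp
  · simp

lemma lift_mapMatrix {K : Type*} [Field K] {m : ℕ} {ι : Type*} [Fintype ι] [DecidableEq ι]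
    {T T' : Type*} [CommRing T] [Algebra K T] [CommRing T'] [Algebra K T'] (f : T →ₐ[K] T')
    (b : Fin m → Matrix ι ι T) (q : FreeAlgebra K (Fin m)) :
    f.mapMatrix (FreeAlgebra.lift K b q) = FreeAlgebra.lift K (fun l => f.mapMatrix (b l)) q := by
  have : f.mapMatrix.comp (FreeAlgebra.lift K b) =
      FreeAlgebra.lift K (fun l => f.mapMatrix (b l)) := by
    ext l : 2
    simp
  exact DFunLike.congr_fun this q

lemma scalar_extend {K : Type*} [Field K] [Infinite K] {m : ℕ} {ι : Type*} [Fintype ι]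
    [DecidableEq ι] [Nonempty ι] (q : FreeAlgebra K (Fin m))
    (hq : ∀ a : Fin m → Matrix ι ι K, ∃ lam : K, FreeAlgebra.lift K a q = lam • 1)
    {T : Type*} [CommRing T] [Algebra K T] (b : Fin m → Matrix ι ι T) :
    ∃ c : T, FreeAlgebra.lift K b q = c • 1 := by
  let G : Fin m → Matrix ι ι (MvPolynomial (Fin m × ι × ι) K) :=
    fun l => Matrix.of fun i j => MvPolynomial.X (l, i, j)
  obtain ⟨i0⟩ := ‹Nonempty ι›
  have hQ : FreeAlgebra.lift K G q = (FreeAlgebra.lift K G q i0 i0) • 1 := by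
    ext1 i j
    apply MvPolynomial.funext
    intro x
    obtain ⟨lam, h⟩ := hq (fun l => (MvPolynomial.aeval x).mapMatrix (G l))
    rw [← lift_mapMatrix] at h
    have h' : ∀ i j, MvPolynomial.eval x (FreeAlgebra.lift K G q i j) =
        (lam • (1 : Matrix ι ι K)) i j := fun i j => congrFun (congrFun h i) j
    rw [h', Matrix.smul_apply, Matrix.smul_apply, smul_eq_mul, smul_eq_mul, map_mul, h',
      Matrix.one_apply, Matrix.one_apply]
    split_ifs <;> simp
  have hb : b = fun l => (MvPolynomial.aeval (R := K)
      (fun s : Fin m × ι × ι => b s.1 s.2.1 s.2.2)).mapMatrix (G l) := by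
    funext l
    ext1 i j
    simp [G]
  rw [hb, ← lift_mapMatrix, hQ]
  refine ⟨MvPolynomial.aeval (R := K) (fun s : Fin m × ι × ι => b s.1 s.2.1 s.2.2)
    (FreeAlgebra.lift K G q i0 i0), ?_⟩
  ext1 i j
  by_cases h : i = j
  · subst h; simp
  · simp [h]

/-- The theorem with matrices indexed by `ZMod n`. -/
lemma scalar_zmod {K : Type*} [Field K] [Infinite K] {m n ν : ℕ} [NeZero n]
    (hν : 1 ≤ ν) (hchar : ¬ (ringChar K ∣ ν)) (hcop : Nat.Coprime ν n)
    (p : FreeAlgebra K (Fin m))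
    (hpow : ∀ a : Fin m → Matrix (ZMod n) (ZMod n) K,
      ∃ lam : K, (FreeAlgebra.lift K a p) ^ ν = lam • (1 : Matrix (ZMod n) (ZMod n) K))
    (a : Fin m → Matrix (ZMod n) (ZMod n) K) :
    ∃ lam : K, FreeAlgebra.lift K a p = lam • (1 : Matrix (ZMod n) (ZMod n) K) := by
  let B := AlgebraicClosure K
  let V := Fin m × ZMod n × ZMod n
  let S := MvPolynomial V B
  let τ : V → V := fun s => (s.1, s.2.1 + 1, s.2.2 + 1)
  have hτ : Function.Injective τ := by
    rintro ⟨l, i, j⟩ ⟨l', i', j'⟩ h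
    have e1 := congrArg (fun s => s.1) h
    have e2 := congrArg (fun s => s.2.1) h
    have e3 := congrArg (fun s => s.2.2) h
    simp only [τ, add_left_inj] at e1 e2 e3
    rw [e1, e2, e3]
  let σ : S →ₐ[B] S := MvPolynomial.rename τ
  have hσ : Function.Injective σ := MvPolynomial.rename_injective τ hτ
  let G : Fin m → Matrix (ZMod n) (ZMod n) (Polynomial S) := fun l => Matrix.of fun i j =>
    Polynomial.C (MvPolynomial.X (l, i, j)) * Polynomial.X ^ (j - i).val
  have hG : ∀ l, G l ∈ twistedAlg n B S σ := by
    intro l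
    refine ⟨fun i j k hk => ?_, fun i j => ?_⟩
    · simp only [G, Matrix.of_apply, Polynomial.coeff_C_mul_X_pow] at hk
      have : k = (j - i).val := by
        by_contra h
        simp [h] at hk
      rw [this, ZMod.natCast_zmod_val]
    · simp [G, σ, τ]
      exact (MvPolynomial.rename_X (R := B) τ (l, i, j)).symm
  have hchar' : (ν : B) ≠ 0 := by
    rw [← map_natCast (algebraMap K B), Ne, map_eq_zero]
    exact fun h => hchar ((ringChar.spec K ν).1 h)
  have hg : FreeAlgebra.lift K G p ∈ twistedAlg n B S σ := by
    clear hpow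
    induction p using FreeAlgebra.induction with
    | grade0 r =>
      rw [AlgHom.commutes, IsScalarTower.algebraMap_apply K B]
      exact Subalgebra.algebraMap_mem _ _
    | grade1 x => simpa using hG x
    | mul x y hx hy => rw [map_mul]; exact mul_mem hx hy
    | add x y hx hy => rw [map_add]; exact add_mem hx hy
  obtain ⟨c, hc⟩ := scalar_extend (p ^ ν) (by simpa using hpow) G
  rw [map_pow] at hc
  obtain ⟨r, hr⟩ := twistedAlg_scalar hσ hν hchar' hcop hg c hc
  let φ : Polynomial S →ₐ[K] B :=
    ((MvPolynomial.aeval (R := B) fun s : V => algebraMap K B (a s.1 s.2.1 s.2.2)).restrictScalars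
      K).comp ((Polynomial.aeval (R := S) (1 : S)).restrictScalars K)
  have hφ : (fun l => φ.mapMatrix (G l)) = fun l => (Algebra.ofId K B).mapMatrix (a l) := by
    funext l
    ext1 i j
    simp [φ, G, Algebra.ofId_apply]
  have key := lift_mapMatrix φ G p
  rw [hφ, ← lift_mapMatrix, hr] at key
  have key' : ∀ i j, algebraMap K B (FreeAlgebra.lift K a p i j) = if i = j then φ r else 0 := by
    intro i j
    have := congrFun (congrFun key i) j
    rw [← Algebra.ofId_apply]
    refine Eq.trans this.symm ?_
    by_cases h : i = j
    · subst h; simp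
    · simp [h]
  refine ⟨FreeAlgebra.lift K a p 0 0, ?_⟩
  ext1 i j
  apply (algebraMap K B).injective
  rw [key', Matrix.smul_apply, Matrix.one_apply]
  split_ifs
  · rw [smul_eq_mul, mul_one, key', if_pos rfl]
  · simp


/-- Let `K` be an infinite field, `ν ≥ 1` with `char K ∤ ν` and `ν` relatively prime to
`n`.  If `p^ν` takes only scalar values on `M_n(K)`, then `p` itself takes only scalar
values on `M_n(K)`.  (In particular a `ν`-central polynomial with `ν > 1` cannot have
`ν` relatively prime to `n`.) -/
theorem scalar_of_pow_scalar_of_coprime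
    {K : Type*} [Field K] [Infinite K] {m n ν : ℕ}
    (hν : 1 ≤ ν) (hchar : ¬ (ringChar K ∣ ν)) (hcop : Nat.Coprime ν n)
    (p : FreeAlgebra K (Fin m))
    (hpow : ∀ a : Fin m → Matrix (Fin n) (Fin n) K,
      ∃ lam : K, (ncEval p a) ^ ν = lam • (1 : Matrix (Fin n) (Fin n) K)) :
    ∀ a : Fin m → Matrix (Fin n) (Fin n) K,
      ∃ lam : K, ncEval p a = lam • (1 : Matrix (Fin n) (Fin n) K) := by
  intro a
  rcases n with _ | k
  · exact ⟨0, by ext i; exact i.elim0⟩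
  · exact scalar_zmod (n := k + 1) hν hchar hcop p hpow a
end

section
/- Let K be an infinite field whose characteristic does not divide n, and let p be a multilinear polynomial in m variables over K. Suppose p is ν-central on M_n(K) for some ν > 1: p^ν takes only scalar values on M_n(K), p^ν does not vanish identically on M_n(K), and for every ℓ with 1 ≤ ℓ < ν, p^ℓ does not take only scalar values on M_n(K). Then ν = n. -/
namespace NuCentral

open Polynomial

/-- Evaluation of a multilinear polynomial over an arbitrary algebra. -/
noncomputable def mlE {R M : Type*} [CommRing R] [Ring M] [Algebra R M] {m : ℕ}
    (c : Equiv.Perm (Fin m) → R) (A : Fin m → M) : M :=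
  ∑ σ : Equiv.Perm (Fin m), c σ • (List.ofFn fun k => A (σ k)).prod

lemma mlE_map {R S M N : Type*} [CommRing R] [CommRing S] [Ring M] [Ring N] [Algebra R M]
    [Algebra S N] {m : ℕ} (f : R → S) (g : M →+* N) (h : ∀ r x, g (r • x) = f r • g x)
    (c : Equiv.Perm (Fin m) → R) (A : Fin m → M) :
    mlE (fun σ => f (c σ)) (fun k => g (A k)) = g (mlE c A) := by
  unfold mlE
  rw [map_sum]
  refine Finset.sum_congr rfl fun σ _ => ?_
  rw [h, map_list_prod, List.map_ofFn]
  rfl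

lemma mlE_mat_map {R S : Type*} [CommRing R] [CommRing S] {m n : ℕ} (f : R →+* S)
    (c : Equiv.Perm (Fin m) → R) (A : Fin m → Matrix (Fin n) (Fin n) R) :
    mlE (fun σ => f (c σ)) (fun k => (A k).map f) = (mlE c A).map f := by
  refine mlE_map f f.mapMatrix ?_ c A
  intro r x
  ext i j
  simp

/-- The multilinear map underlying `mlE`. -/
noncomputable def mlM {R M : Type*} [CommRing R] [Ring M] [Algebra R M] {m : ℕ}
    (c : Equiv.Perm (Fin m) → R) : MultilinearMap R (fun _ : Fin m => M) M :=
  ∑ σ : Equiv.Perm (Fin m), c σ • (MultilinearMap.mkPiAlgebraFin R m M).domDomCongr σ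

lemma mlM_apply {R M : Type*} [CommRing R] [Ring M] [Algebra R M] {m : ℕ}
    (c : Equiv.Perm (Fin m) → R) (A : Fin m → M) : mlM c A = mlE c A := by
  simp [mlM, mlE]

section hom
variable {R : Type*} [CommRing R] {n m : ℕ} [NeZero n]

/-- Homogeneous matrices for the cyclic grading. -/
def Hom (d : Fin n) (M : Matrix (Fin n) (Fin n) R) : Prop := ∀ i j, j ≠ i + d → M i j = 0

lemma Hom.one : Hom (0 : Fin n) (1 : Matrix (Fin n) (Fin n) R) := by
  intro i j h
  apply Matrix.one_apply_ne
  rintro rfl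
  simp at h

lemma Hom.mul {d e : Fin n} {M N : Matrix (Fin n) (Fin n) R} (hM : Hom d M) (hN : Hom e N) :
    Hom (d + e) (M * N) := by
  intro i j h
  rw [Matrix.mul_apply]
  refine Finset.sum_eq_zero fun k _ => ?_
  by_cases hk : k = i + d
  · rw [hN k j, mul_zero]
    rintro rfl
    apply h
    rw [hk, add_assoc]
  · rw [hM i k hk, zero_mul]

lemma Hom.listProd (L : List (Matrix (Fin n) (Fin n) R × Fin n)) (h : ∀ x ∈ L, Hom x.2 x.1) :
    Hom (L.map Prod.snd).sum (L.map Prod.fst).prod := by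
  induction L with
  | nil => simpa using Hom.one
  | cons a L ih =>
    simp only [List.map_cons, List.sum_cons, List.prod_cons]
    exact (h a (by simp)).mul (ih fun x hx => h x (by simp [hx]))

lemma Hom.mlE {d : Fin m → Fin n} {A : Fin m → Matrix (Fin n) (Fin n) R}
    (c : Equiv.Perm (Fin m) → R) (h : ∀ k, Hom (d k) (A k)) : Hom (∑ k, d k) (mlE c A) := by
  intro i j hij
  unfold NuCentral.mlE
  rw [Matrix.sum_apply]
  refine Finset.sum_eq_zero fun σ _ => ?_
  have := Hom.listProd (List.ofFn fun k => (A (σ k), d (σ k))) (by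
    intro x hx
    rw [List.mem_ofFn] at hx
    obtain ⟨k, rfl⟩ := hx
    exact h _)
  rw [List.map_ofFn, List.map_ofFn, List.sum_ofFn] at this
  have h2 : (∑ k, (Prod.snd ∘ fun k => (A (σ k), d (σ k))) k) = ∑ k, d k :=
    Equiv.sum_comp σ d
  rw [h2] at this
  rw [Matrix.smul_apply]
  have h3 := this i j hij
  have h4 : (List.ofFn fun k => A (σ k)).prod i j = 0 := h3
  rw [h4, smul_zero]

lemma Hom.pow {d : Fin n} {M : Matrix (Fin n) (Fin n) R} (hM : Hom d M) (j : ℕ) :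
    Hom (j • d) (M ^ j) := by
  induction j with
  | zero => simpa using Hom.one
  | succ j ih => rw [pow_succ, succ_nsmul]; exact ih.mul hM

lemma Hom.pow_ne [IsDomain R] {d : Fin n} {M : Matrix (Fin n) (Fin n) R} (hM : Hom d M)
    (h : ∀ i, M i (i + d) ≠ 0) (j : ℕ) (i : Fin n) : (M ^ j) i (i + j • d) ≠ 0 := by
  induction j with
  | zero => simp
  | succ j ih =>
    rw [pow_succ, succ_nsmul, Matrix.mul_apply, Finset.sum_eq_single (i + j • d), ← add_assoc]
    · exact mul_ne_zero ih (h _)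
    · intro k _ hk
      rw [hM.pow j i k hk, zero_mul]
    · simp

lemma val_nsmul_one (j : ℕ) : ((j • (1 : Fin n) : Fin n) : ℕ) = j % n := by
  induction j with
  | zero => simp
  | succ j ih =>
    rw [succ_nsmul, Fin.val_add, ih]
    simp

end hom

section field
variable {K : Type*} [Field K] {n m : ℕ}

/-- Conjugation as a ring homomorphism. -/
def conjHom {M : Type*} [Ring M] (U V : M) (h : V * U = 1) (h' : U * V = 1) : M →+* M where
  toFun x := U * x * V
  map_one' := by simp [h']
  map_zero' := by simp
  map_add' x y := by simp [mul_add, add_mul]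
  map_mul' x y := by
    have : U * x * V * (U * y * V) = U * x * (V * U) * y * V := by simp only [mul_assoc]
    rw [this, h]; simp [mul_assoc]

/-- A noncentral value yields a value with a nonzero off-diagonal entry. -/
lemma exists_offdiag (c : Equiv.Perm (Fin m) → K) (A : Fin m → Matrix (Fin n) (Fin n) K)
    (hn : 0 < n)
    (hA : ∀ lam : K, mlE c A ≠ lam • (1 : Matrix (Fin n) (Fin n) K)) :
    ∃ (B : Fin m → Matrix (Fin n) (Fin n) K) (a b : Fin n), a ≠ b ∧ mlE c B a b ≠ 0 := by
  by_contra! hcon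
  apply hA (mlE c A ⟨0, hn⟩ ⟨0, hn⟩)
  ext i j
  by_cases hij : i = j
  · subst hij
    simp only [Matrix.smul_apply, Matrix.one_apply_eq, smul_eq_mul, mul_one]
    by_contra hne
    set a : Fin n := ⟨0, hn⟩
    have hia : i ≠ a := by rintro rfl; exact hne rfl
    have h1 : Matrix.transvection i a (1 : K) * Matrix.transvection i a (-1) = 1 := by
      rw [Matrix.transvection_mul_transvection_same _ _ hia]; simp
    have h2 : Matrix.transvection i a (-1 : K) * Matrix.transvection i a (1) = 1 := by
      rw [Matrix.transvection_mul_transvection_same _ _ hia]; simp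
    have h3 := mlE_map (fun x : K => x) (conjHom _ _ h2 h1) (by
      intro r x; simp [conjHom]) c A
    have h4 := hcon (fun k => conjHom _ _ h2 h1 (A k)) i a hia
    rw [h3] at h4
    have h5 := hcon A i a hia
    have h6 := hcon A a i hia.symm
    simp [conjHom, Matrix.transvection, add_mul, mul_add, h5, h6] at h4
    apply hne
    linear_combination -h4
  · rw [hcon A i j hij]
    simp [hij]

lemma exists_units (c : Equiv.Perm (Fin m) → K) (B : Fin m → Matrix (Fin n) (Fin n) K)
    (a b : Fin n) (h : mlE c B a b ≠ 0) :
    ∃ u v : Fin m → Fin n, mlE c (fun k => Matrix.single (u k) (v k) (1 : K)) a b ≠ 0 := by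
  by_contra! hcon
  apply h
  have : (Matrix.entryLinearMap K K a b).compMultilinearMap
      (mlM (M := Matrix (Fin n) (Fin n) K) c) = 0 := by
    refine Module.Basis.ext_multilinear (fun _ => Matrix.stdBasis K (Fin n) (Fin n)) ?_
    intro w
    have := hcon (fun k => (w k).1) (fun k => (w k).2)
    simp only [LinearMap.compMultilinearMap_apply, mlM_apply]
    have hw : (fun i => (Matrix.stdBasis K (Fin n) (Fin n)) (w i)) =
        fun k => Matrix.single (w k).1 (w k).2 1 := by
      funext k
      exact Matrix.stdBasis_eq_single K (w k).1 (w k).2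
    rw [hw]
    simpa using this
  have h2 := congrArg (fun f => f B) this
  simpa [mlM_apply] using h2

lemma mlE_submatrix (c : Equiv.Perm (Fin m) → K) (B : Fin m → Matrix (Fin n) (Fin n) K)
    (e : Equiv.Perm (Fin n)) :
    mlE c (fun k => (B k).submatrix e e) = (mlE c B).submatrix e e := by
  have := mlE_map (fun x : K => x)
    ((Matrix.reindexAlgEquiv K K e.symm).toRingEquiv.toRingHom) (by
      intro r x; ext i j; simp) c B
  simpa using this

/-- A value which is a weighted cyclic permutation matrix. -/
lemma exists_cyclic [Infinite K] [NeZero n] (hn : 1 < n) (c : Equiv.Perm (Fin m) → K)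
    (A : Fin m → Matrix (Fin n) (Fin n) K)
    (hA : ∀ lam : K, mlE c A ≠ lam • (1 : Matrix (Fin n) (Fin n) K)) :
    ∃ B : Fin m → Matrix (Fin n) (Fin n) K, Hom 1 (mlE c B) ∧ ∀ i, mlE c B i (i + 1) ≠ 0 := by
  obtain ⟨B, a, b, hab, hB⟩ := exists_offdiag c A (by omega) hA
  obtain ⟨u, v, huv⟩ := exists_units c B a b hB
  have h01 : (0 : Fin n) ≠ 1 := by
    intro h
    have := congrArg Fin.val h
    rw [Fin.val_one', Nat.mod_eq_of_lt hn] at this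
    simp at this
  -- permutation with `τ 0 = a`, `τ 1 = b`
  obtain ⟨τ, hτ0, hτ1⟩ : ∃ τ : Equiv.Perm (Fin n), τ 0 = a ∧ τ 1 = b := by
    refine ⟨(Equiv.swap 0 a).trans (Equiv.swap (Equiv.swap 0 a 1) b), ?_, ?_⟩
    · simp only [Equiv.trans_apply, Equiv.swap_apply_left]
      apply Equiv.swap_apply_of_ne_of_ne _ hab
      intro h
      exact h01 ((Equiv.swap 0 a).injective ((Equiv.swap_apply_left 0 a).trans h))
    · simp
  set d : Fin m → Fin n := fun k => τ.symm (v k) - τ.symm (u k) with hd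
  have key : ∀ i : Fin n, ∃ B : Fin m → Matrix (Fin n) (Fin n) K,
      (∀ k, Hom (d k) (B k)) ∧ mlE c B i (i + 1) ≠ 0 := by
    intro i
    set e : Equiv.Perm (Fin n) := (Equiv.subRight i).trans τ with he
    refine ⟨fun k => (Matrix.single (u k) (v k) (1 : K)).submatrix e e, ?_, ?_⟩
    · intro k x y hxy
      change Matrix.single (u k) (v k) (1 : K) (e x) (e y) = 0
      rw [Matrix.single_apply, if_neg]
      rintro ⟨h1, h2⟩
      apply hxy
      simp only [hd, h1, h2, he]
      simp
    · rw [mlE_submatrix]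
      simpa [he, hτ0, hτ1] using huv
  have hsum : ∑ k, d k = 1 := by
    obtain ⟨B, hB1, hB2⟩ := key 0
    by_contra hne
    apply hB2
    apply Hom.mlE c hB1
    simpa using Ne.symm hne
  let G : Fin m → Matrix (Fin n) (Fin n) (MvPolynomial (Fin m × Fin n) K) :=
    fun k => Matrix.of fun x y => if y = x + d k then MvPolynomial.X (k, x) else 0
  let P := mlE (fun σ => (MvPolynomial.C (c σ) : MvPolynomial (Fin m × Fin n) K)) G
  have hP : ∀ t : Fin m × Fin n → K, mlE c (fun k => (G k).map (MvPolynomial.eval t)) =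
      P.map (MvPolynomial.eval t) := by
    intro t
    have := mlE_mat_map (MvPolynomial.eval t) (fun σ => MvPolynomial.C (c σ)) G
    simpa using this
  have hPi : ∀ i, P i (i + 1) ≠ 0 := by
    intro i h0
    obtain ⟨B, hB1, hB2⟩ := key i
    apply hB2
    have h1 := hP (fun q => B q.1 q.2 (q.2 + d q.1))
    have h2 : (fun k => (G k).map (MvPolynomial.eval (fun q => B q.1 q.2 (q.2 + d q.1)))) = B := by
      funext k
      ext x y
      simp only [G, Matrix.map_apply, Matrix.of_apply]
      split_ifs with hy
      · simp [hy]
      · simp [hB1 k x y hy]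
    rw [h2] at h1
    rw [h1, Matrix.map_apply, h0, map_zero]
  have hprod : (∏ i, P i (i + 1)) ≠ 0 := Finset.prod_ne_zero_iff.mpr fun i _ => hPi i
  obtain ⟨t, ht⟩ : ∃ t, MvPolynomial.eval t (∏ i, P i (i + 1)) ≠ 0 := by
    by_contra! hcon
    exact hprod (MvPolynomial.funext (by simpa using hcon))
  refine ⟨fun k => (G k).map (MvPolynomial.eval t), ?_, ?_⟩
  · rw [← hsum]
    apply Hom.mlE
    intro k x y hxy
    simp [G, hxy]
  · intro i
    rw [hP, Matrix.map_apply]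
    rw [map_prod] at ht
    exact Finset.prod_ne_zero_iff.mp ht i (Finset.mem_univ _)

lemma charpoly_coeff_cyclic [NeZero n] {X : Matrix (Fin n) (Fin n) K}
    (hX : Hom 1 X) (hX' : ∀ i, X i (i + 1) ≠ 0) (k : ℕ) (hk0 : 0 < k) (hk : k < n) :
    X.charpoly.coeff k = 0 := by
  have h := Matrix.aeval_self_charpoly X
  rw [Polynomial.aeval_eq_sum_range] at h
  have h2 := congrFun (congrFun h 0) (0 + k • (1 : Fin n))
  rw [Matrix.sum_apply, Finset.sum_eq_single k] at h2
  · rw [Matrix.smul_apply, smul_eq_mul] at h2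
    exact (mul_eq_zero.mp h2).resolve_right (hX.pow_ne hX' k 0)
  · intro j hj hjk
    rw [Matrix.charpoly_natDegree_eq_dim, Fintype.card_fin, Finset.mem_range] at hj
    rw [Matrix.smul_apply, hX.pow j, smul_zero]
    intro h
    have := congrArg Fin.val (add_left_cancel h)
    rw [val_nsmul_one, val_nsmul_one, Nat.mod_eq_of_lt hk] at this
    rcases Nat.lt_or_ge j n with hj' | hj'
    · rw [Nat.mod_eq_of_lt hj'] at this; omega
    · obtain rfl : j = n := by omega
      simp at this; omega
  · intro hk'
    rw [Matrix.charpoly_natDegree_eq_dim, Fintype.card_fin, Finset.mem_range] at hk'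
    omega

/-- Charpolys of matrices over an algebraically closed field whose `ν`-th power is one form a
finite set. -/
lemma finite_charpolys (L : Type*) [Field L] [IsAlgClosed L] (n ν : ℕ) (hν : 0 < ν) :
    {q : L[X] | ∃ A : Matrix (Fin n) (Fin n) L, A ^ ν = 1 ∧ q = A.charpoly}.Finite := by
  classical
  let s : Multiset L := n • (nthRootsFinset ν (1 : L)).val
  refine ((s.powerset.toFinset.image
    (fun t : Multiset L => (t.map fun a => X - C a).prod)).finite_toSet).subset ?_
  rintro q ⟨A, hA, rfl⟩
  simp only [Finset.coe_image, Set.mem_image, Finset.mem_coe, Multiset.mem_toFinset,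
    Multiset.mem_powerset]
  refine ⟨A.charpoly.roots, ?_, ?_⟩
  · rw [Multiset.le_iff_count]
    intro a
    by_cases ha : a ∈ A.charpoly.roots
    · have h1 : A.charpoly.roots.count a ≤ n := by
        refine (Multiset.count_le_card _ _).trans ((card_roots' _).trans ?_)
        rw [Matrix.charpoly_natDegree_eq_dim, Fintype.card_fin]
      have h2 : a ∈ nthRootsFinset ν (1 : L) := by
        rw [mem_nthRootsFinset hν]
        have h4 : a ∈ spectrum L A :=
          Matrix.mem_spectrum_iff_isRoot_charpoly.mpr (isRoot_of_mem_roots ha)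
        have h5 := spectrum.pow_mem_pow A ν h4
        rw [hA, spectrum.mem_iff] at h5
        by_contra hne
        apply h5
        have h6 : algebraMap L (Matrix (Fin n) (Fin n) L) (a ^ ν) - 1 =
            algebraMap L (Matrix (Fin n) (Fin n) L) (a ^ ν - 1) := by
          rw [map_sub, map_one]
        rw [h6]
        exact (IsUnit.mk0 _ (sub_ne_zero.mpr hne)).map _
      have h3 : 1 ≤ (nthRootsFinset ν (1 : L)).val.count a :=
        Multiset.one_le_count_iff_mem.mpr h2
      simp only [s, Multiset.count_nsmul]
      nlinarith
    · rw [Multiset.count_eq_zero_of_notMem ha]; exact Nat.zero_le _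
  · exact ((IsAlgClosed.splits A.charpoly).eq_prod_roots_of_monic A.charpoly_monic).symm

lemma charpoly_smul_coeff {L : Type*} [Field L] (A : Matrix (Fin n) (Fin n) L) (μ : L) (k : ℕ)
    (hk : k ≤ n) (hμ : μ ≠ 0) : (μ • A).charpoly.coeff k = μ ^ (n - k) * A.charpoly.coeff k := by
  have h1 : (μ • A).charpoly.comp (C μ * X) = C (μ ^ n) * A.charpoly := by
    have h2 : (μ • A).charpoly.comp (C μ * X) =
        ((compRingHom (C μ * X)).mapMatrix (μ • A).charmatrix).det := by
      rw [← RingHom.map_det]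
      rfl
    have h3 : (compRingHom (C μ * X)).mapMatrix (μ • A).charmatrix = C μ • A.charmatrix := by
      ext1 i j
      by_cases hij : i = j
      · subst hij
        simp [Matrix.charmatrix_apply_eq, mul_sub]
      · simp [Matrix.charmatrix_apply_ne _ _ _ hij]
    rw [h2, h3, Matrix.det_smul, Fintype.card_fin, C_pow]
    rfl
  have h4 := congrArg (fun q => coeff q k) h1
  simp only [comp_C_mul_X_coeff, coeff_C_mul] at h4
  have h5 : μ ^ n = μ ^ (n - k) * μ ^ k := by rw [← pow_add, Nat.sub_add_cancel hk]
  rw [h5] at h4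
  apply mul_right_cancel₀ (pow_ne_zero k hμ)
  rw [h4]
  ring

lemma coeff_finite (L : Type*) [Field L] [IsAlgClosed L] (n ν k : ℕ) (hν : 0 < ν) (hk : k < n) :
    ∃ S : Finset L, ∀ (A : Matrix (Fin n) (Fin n) L) (lam : L),
      A ^ ν = lam • (1 : Matrix (Fin n) (Fin n) L) →
      ∃ α ∈ S, A.charpoly.coeff k ^ ν = α * lam ^ (n - k) := by
  classical
  refine ⟨insert 0 ((finite_charpolys L n ν hν).toFinset.image fun q => q.coeff k ^ ν), ?_⟩
  intro A lam h
  by_cases hl : lam = 0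
  · refine ⟨0, by simp, ?_⟩
    have h0 : IsNilpotent A := ⟨ν, by rw [h, hl, zero_smul]⟩
    have h1 : A.charpoly = X ^ n := by
      have h2 := (Matrix.isNilpotent_charpoly_sub_pow_of_isNilpotent h0).eq_zero
      rw [Fintype.card_fin] at h2
      exact sub_eq_zero.mp h2
    rw [h1, coeff_X_pow, if_neg hk.ne, zero_mul, zero_pow hν.ne']
  · obtain ⟨μ, hμ⟩ := IsAlgClosed.exists_pow_nat_eq lam hν
    have hμ0 : μ ≠ 0 := by
      rintro rfl
      rw [zero_pow hν.ne'] at hμ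
      exact hl hμ.symm
    refine ⟨(μ⁻¹ • A).charpoly.coeff k ^ ν, ?_, ?_⟩
    · apply Finset.mem_insert_of_mem
      refine Finset.mem_image.mpr ⟨_, ?_, rfl⟩
      rw [Set.Finite.mem_toFinset]
      refine ⟨_, ?_, rfl⟩
      rw [_root_.smul_pow, h, smul_smul, ← hμ, ← mul_pow, inv_mul_cancel₀ hμ0, one_pow, one_smul]
    · have : A = μ • (μ⁻¹ • A) := by rw [smul_smul, mul_inv_cancel₀ hμ0, one_smul]
      conv_lhs => rw [this]
      rw [charpoly_smul_coeff _ _ _ hk.le hμ0, mul_pow, ← pow_mul, mul_comm (n - k) ν, pow_mul, hμ,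
        mul_comm]

lemma coeff_zero_of_path [Infinite K] [NeZero n] {ν : ℕ} (hν : 0 < ν)
    (c : Equiv.Perm (Fin m) → K)
    (hsc : ∀ A : Fin m → Matrix (Fin n) (Fin n) K,
      ∃ lam : K, (mlE c A) ^ ν = lam • (1 : Matrix (Fin n) (Fin n) K))
    (A B : Fin m → Matrix (Fin n) (Fin n) K) (hB1 : Hom 1 (mlE c B))
    (hB2 : ∀ i, mlE c B i (i + 1) ≠ 0) (k : ℕ) (hk0 : 0 < k) (hk : k < n) :
    (mlE c A).charpoly.coeff k = 0 := by
  classical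
  let L := AlgebraicClosure K
  let ι : K →+* L := algebraMap K L
  obtain ⟨S, hS⟩ := coeff_finite L n ν k hν hk
  let T : Fin m → Matrix (Fin n) (Fin n) K[X] := fun j =>
    (A j).map C + (X : K[X]) • (B j - A j).map C
  let M := mlE (fun σ => (C (c σ) : K[X])) T
  have hM : ∀ s : K, mlE c (fun j => A j + s • (B j - A j)) = M.map (evalRingHom s) := by
    intro s
    have := mlE_mat_map (evalRingHom s) (fun σ => C (c σ)) T
    rw [← this]
    congr 1
    · simp
    · funext j
      ext x y
      simp [T]
  let f : K[X] := M.charpoly.coeff k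
  let g : K[X] := (M ^ ν) 0 0
  have hf : ∀ s : K, eval s f = (mlE c (fun j => A j + s • (B j - A j))).charpoly.coeff k := by
    intro s
    rw [hM, Matrix.charpoly_map, coeff_map]
    rfl
  have hg : ∀ s : K, (mlE c (fun j => A j + s • (B j - A j))) ^ ν =
      eval s g • (1 : Matrix (Fin n) (Fin n) K) := by
    intro s
    obtain ⟨lam, hlam⟩ := hsc (fun j => A j + s • (B j - A j))
    have h1 : eval s g = lam := by
      have h2 : (M ^ ν).map (evalRingHom s) = (M.map (evalRingHom s)) ^ ν :=
        map_pow (evalRingHom s).mapMatrix M ν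
      have h3 := congrFun (congrFun h2 0) 0
      rw [← hM, hlam] at h3
      simpa using h3
    rw [hlam, h1]
  have hprod : ∏ α ∈ S, ((f.map ι) ^ ν - C α * (g.map ι) ^ (n - k)) = 0 := by
    have hinf : (Set.range ι).Infinite := Set.infinite_range_of_injective ι.injective
    refine Polynomial.eq_zero_of_infinite_isRoot _ (hinf.mono ?_)
    rintro _ ⟨s, rfl⟩
    obtain ⟨α, hα, h⟩ := hS ((mlE c (fun j => A j + s • (B j - A j))).map ι) (ι (eval s g)) (by
      have h1 := map_pow ι.mapMatrix (mlE c (fun j => A j + s • (B j - A j))) ν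
      rw [hg] at h1
      simp only [RingHom.mapMatrix_apply] at h1
      rw [← h1]
      ext x y
      by_cases hxy : x = y <;> simp [Matrix.one_apply, hxy])
    rw [Matrix.charpoly_map, coeff_map, ← hf] at h
    simp only [Set.mem_ofPred_eq, IsRoot.def, eval_prod]
    refine Finset.prod_eq_zero hα ?_
    simp [eval_map_apply, h]
  obtain ⟨α, -, hα⟩ := Finset.prod_eq_zero_iff.mp hprod
  have hev : ∀ s : K, ι (eval s f) ^ ν = α * ι (eval s g) ^ (n - k) := by
    intro s
    have := congrArg (eval (ι s)) hα
    simp only [eval_sub, eval_mul, eval_pow, eval_C, eval_map_apply, eval_zero] at this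
    exact sub_eq_zero.mp this
  have h1f : eval 1 f = 0 := by
    rw [hf]
    simpa using charpoly_coeff_cyclic hB1 hB2 k hk0 hk
  have h1g : eval 1 g ≠ 0 := by
    intro h0
    have h1 := hg 1
    rw [h0] at h1
    simp only [one_smul, add_sub_cancel, zero_smul] at h1
    have h2 := hB1.pow_ne hB2 ν 0
    apply h2
    have h3 := congrFun (congrFun h1 0) (0 + ν • (1 : Fin n))
    simpa using h3
  have hα0 : α = 0 := by
    have := hev 1
    rw [h1f, map_zero, zero_pow hν.ne'] at this
    have h2 : ι (eval 1 g) ≠ 0 := by simpa using h1g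
    exact (mul_eq_zero.mp this.symm).resolve_right (pow_ne_zero _ h2)
  have h0 := hev 0
  rw [hα0, zero_mul, hf] at h0
  simpa [hν.ne'] using h0

end field

end NuCentral

theorem nu_central_multilinear_eq_n_of_char_not_dvd
    {K : Type*} [Field K] [Infinite K] {m n ν : ℕ}
    (hchar : ¬ (ringChar K ∣ n)) (hν : 1 < ν)
    (c : Equiv.Perm (Fin m) → K)
    (hsc : ∀ A : Fin m → Matrix (Fin n) (Fin n) K,
      ∃ lam : K, (mlEval c A) ^ ν = lam • (1 : Matrix (Fin n) (Fin n) K))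
    (hnz : ∃ A : Fin m → Matrix (Fin n) (Fin n) K, (mlEval c A) ^ ν ≠ 0)
    (hmin : ∀ ℓ : ℕ, 1 ≤ ℓ → ℓ < ν →
      ∃ A : Fin m → Matrix (Fin n) (Fin n) K,
        ∀ lam : K, (mlEval c A) ^ ℓ ≠ lam • (1 : Matrix (Fin n) (Fin n) K)) :
    ν = n := by
  have hE : ∀ A : Fin m → Matrix (Fin n) (Fin n) K, mlEval c A = NuCentral.mlE c A :=
    fun _ => rfl
  simp only [hE] at hsc hmin
  have hn0 : n ≠ 0 := by
    rintro rfl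
    exact hchar (dvd_zero _)
  haveI : NeZero n := ⟨hn0⟩
  obtain ⟨A₀, hA₀⟩ := hmin 1 le_rfl hν
  simp only [pow_one] at hA₀
  have hn1 : 1 < n := by
    by_contra hcon
    obtain rfl : n = 1 := by omega
    apply hA₀ (NuCentral.mlE c A₀ 0 0)
    ext i j
    rw [Subsingleton.elim i 0, Subsingleton.elim j 0]
    simp
  obtain ⟨B, hB1, hB2⟩ := NuCentral.exists_cyclic hn1 c A₀ hA₀
  apply le_antisymm
  · by_contra! hlt
    obtain ⟨A, hA⟩ := hmin n hn1.le hlt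
    apply hA (-(NuCentral.mlE c A).charpoly.coeff 0)
    have h := Matrix.aeval_self_charpoly (NuCentral.mlE c A)
    rw [Polynomial.aeval_eq_sum_range, Matrix.charpoly_natDegree_eq_dim, Fintype.card_fin,
      Finset.sum_range_succ, Finset.sum_eq_single 0] at h
    · have h1 : (NuCentral.mlE c A).charpoly.coeff n = 1 := by
        have := (NuCentral.mlE c A).charpoly_monic.coeff_natDegree
        rwa [Matrix.charpoly_natDegree_eq_dim, Fintype.card_fin] at this
      rw [h1, one_smul, pow_zero] at h
      rw [neg_smul]
      exact eq_neg_of_add_eq_zero_right h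
    · intro k hk hk0
      rw [NuCentral.coeff_zero_of_path (by omega) c hsc A B hB1 hB2 k (by omega)
        (Finset.mem_range.mp hk), zero_smul]
    · intro h0
      exact absurd (Finset.mem_range.mpr (by omega)) h0
  · obtain ⟨lam, hlam⟩ := hsc B
    have h1 := hB1.pow_ne hB2 ν 0
    rw [hlam] at h1
    have h2 : (ν • (1 : Fin n) : Fin n) = 0 := by
      by_contra hne
      apply h1
      rw [Matrix.smul_apply, Matrix.one_apply_ne, smul_zero]
      simpa using Ne.symm hne
    have h3 := NuCentral.val_nsmul_one (n := n) ν
    rw [h2, Fin.val_zero] at h3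
    exact Nat.le_of_dvd (by omega) (Nat.dvd_of_mod_eq_zero h3.symm)
end

section
/- Let K be an infinite field (of arbitrary characteristic) and let p be a multilinear polynomial in m variables over K. Suppose p is ν-central on M_n(K) for some ν > 1: p^ν takes only scalar values on M_n(K), p^ν does not vanish identically on M_n(K), and for every ℓ with 1 ≤ ℓ < ν, p^ℓ does not take only scalar values on M_n(K). Then ν = n. -/
open Polynomial in
lemma aux_exists_fun {L : Type*} [Field L] [IsAlgClosed L] {n : ℕ} (q : L[X]) (hq : q.Monic)
    (hd : q.natDegree = n) : ∃ f : Fin n → L, q = ∏ i, (X - C (f i)) := by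
  have hs : q.Splits := IsAlgClosed.splits q
  have hc : q.roots.toList.length = n := by
    rw [Multiset.length_toList, ← hd]; exact hs.natDegree_eq_card_roots.symm
  subst hc
  refine ⟨fun i => q.roots.toList.get i, ?_⟩
  have h1 : q = (q.roots.map (fun a => X - C a)).prod := by
    have := hs.eq_prod_roots
    rw [hq.leadingCoeff] at this
    simpa using this
  rw [← List.prod_ofFn]
  conv_lhs => rw [h1]
  conv_lhs => rw [← Multiset.coe_toList q.roots]
  rw [Multiset.map_coe, Multiset.prod_coe]
  congr 1
  apply List.ext_get <;> simp

open Polynomial in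
lemma aux_scale {L : Type*} [Field L] {ι : Type*} (s : Finset ι) (f : ι → L) (μ : L) :
    (∏ i ∈ s, (X - C (f i * μ))) = (∏ i ∈ s, (X - C (f i))).scaleRoots μ := by
  classical
  induction s using Finset.induction_on with
  | empty => simp
  | insert a s ha ih =>
    rw [Finset.prod_insert ha, Finset.prod_insert ha, mul_scaleRoots_of_noZeroDivisors, ih]
    congr 1
    ext k
    rw [coeff_scaleRoots, natDegree_X_sub_C]
    rcases k with _ | _ | k <;> simp [coeff_X, coeff_C]

open Polynomial in
lemma aux_pointwise {L : Type*} [Field L] [IsAlgClosed L] {n ν : ℕ} (hν : 0 < ν) (hn : 0 < n)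
    (k : ℕ) : ∃ S : Finset L, ∀ (N : Matrix (Fin n) (Fin n) L) (s : L),
      N ^ ν = s • (1 : Matrix (Fin n) (Fin n) L) →
        ∃ α ∈ S, (N.charpoly.coeff k) ^ ν = α * s ^ (n - k) := by
  classical
  refine ⟨(Fintype.piFinset (fun _ : Fin n => (nthRoots ν (1 : L)).toFinset)).image
    (fun f => ((∏ i, (X - C (f i))).coeff k) ^ ν), ?_⟩
  intro N s hN
  have : Nonempty (Fin n) := ⟨⟨0, hn⟩⟩
  obtain ⟨f, hf⟩ := aux_exists_fun (n := n) N.charpoly N.charpoly_monic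
    (by rw [Matrix.charpoly_natDegree_eq_dim, Fintype.card_fin])
  have hroot : ∀ i, f i ^ ν = s := by
    intro i
    have h1 : N.charpoly.IsRoot (f i) := by
      rw [hf, IsRoot.def, eval_prod]
      exact Finset.prod_eq_zero (Finset.mem_univ i) (by simp)
    have h2 : f i ∈ spectrum L N := Matrix.mem_spectrum_of_isRoot_charpoly h1
    have h3 := spectrum.pow_mem_pow N ν h2
    rw [hN, ← Algebra.algebraMap_eq_smul_one, spectrum.scalar_eq] at h3
    simpa using h3
  obtain ⟨μ, hμ⟩ := IsAlgClosed.exists_pow_nat_eq s hν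
  obtain ⟨g, hg⟩ : ∃ g : Fin n → L, ∀ i, g i ^ ν = 1 ∧ f i = g i * μ := by
    by_cases h0 : μ = 0
    · refine ⟨fun _ => 1, fun i => ⟨by simp, ?_⟩⟩
      have : f i ^ ν = 0 := by rw [hroot, ← hμ, h0, zero_pow hν.ne']
      rw [h0, mul_zero]
      exact pow_eq_zero_iff hν.ne' |>.1 this
    · refine ⟨fun i => f i / μ, fun i => ⟨?_, by field_simp⟩⟩
      rw [div_pow, hroot, hμ, div_self]
      rw [← hμ]; exact pow_ne_zero _ h0
  refine ⟨_, Finset.mem_image.2 ⟨g, ?_, rfl⟩, ?_⟩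
  · simp only [Fintype.mem_piFinset, Multiset.mem_toFinset]
    intro i
    rw [mem_nthRoots hν]
    exact (hg i).1
  · have h4 : N.charpoly = (∏ i, (X - C (g i))).scaleRoots μ := by
      rw [← aux_scale, hf]
      exact Finset.prod_congr rfl (fun i _ => by rw [(hg i).2])
    rw [h4, coeff_scaleRoots]
    have h5 : (∏ i, (X - C (g i))).natDegree = n := by
      rw [natDegree_prod_of_monic _ _ (fun i _ => monic_X_sub_C _)]
      simp
    rw [h5, mul_pow, ← hμ, ← pow_mul, ← pow_mul, mul_comm ν]

section
variable {K : Type*} [Field K] {m n : ℕ}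

/-- the multilinear map -/
noncomputable def mlMap (n : ℕ) (c : Equiv.Perm (Fin m) → K) :
    MultilinearMap K (fun _ : Fin m => Matrix (Fin n) (Fin n) K) (Matrix (Fin n) (Fin n) K) :=
  ∑ σ : Equiv.Perm (Fin m), c σ •
    (MultilinearMap.mkPiAlgebraFin K m (Matrix (Fin n) (Fin n) K)).domDomCongr σ

lemma mlMap_apply (c : Equiv.Perm (Fin m) → K) (A : Fin m → Matrix (Fin n) (Fin n) K) :
    mlMap n c A = mlEval c A := by
  simp [mlMap, mlEval]

lemma mlEval_map (c : Equiv.Perm (Fin m) → K) (A : Fin m → Matrix (Fin n) (Fin n) K)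
    (φ : Matrix (Fin n) (Fin n) K →ₐ[K] Matrix (Fin n) (Fin n) K) :
    mlEval c (fun k => φ (A k)) = φ (mlEval c A) := by
  simp only [mlEval, map_sum, map_smul, map_list_prod, List.map_ofFn]
  rfl

/-- conjugation -/
noncomputable def conjHom (g g' : Matrix (Fin n) (Fin n) K) (h : g' * g = 1) (h' : g * g' = 1) :
    Matrix (Fin n) (Fin n) K →ₐ[K] Matrix (Fin n) (Fin n) K :=
  AlgHom.ofLinearMap ((LinearMap.mulLeft K g).comp (LinearMap.mulRight K g')) (by simp [h'])
    (by
      intro x y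
      simp only [LinearMap.comp_apply, LinearMap.mulLeft_apply, LinearMap.mulRight_apply]
      calc g * (x * y * g') = g * (x * 1 * y * g') := by simp
        _ = _ := by rw [← h]; simp only [mul_assoc])

lemma exists_offdiag (c : Equiv.Perm (Fin m) → K)
    (h : ∃ A : Fin m → Matrix (Fin n) (Fin n) K,
        ∀ lam : K, (mlEval c A) ≠ lam • (1 : Matrix (Fin n) (Fin n) K)) :
    ∃ (A : Fin m → Matrix (Fin n) (Fin n) K) (i j : Fin n), i ≠ j ∧ mlEval c A i j ≠ 0 := by
  by_contra! hcon
  obtain ⟨A, hA⟩ := h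
  have hd : ∀ i j, mlEval c A i i = mlEval c A j j := by
    intro i j
    by_cases hij : i = j
    · rw [hij]
    have e0 : (Matrix.single i j (1 : K)) * Matrix.single i j 1 = 0 := by
      apply Matrix.single_mul_single_of_ne; exact Ne.symm hij
    have h1 : (1 - Matrix.single i j (1 : K)) * (1 + Matrix.single i j (1 : K)) = 1 := by
      rw [sub_mul, mul_add, mul_add, e0]; simp
    have h2 : (1 + Matrix.single i j (1 : K)) * (1 - Matrix.single i j (1 : K)) = 1 := by
      rw [mul_sub, add_mul, add_mul, e0]; simp
    have h3 := hcon (fun k => conjHom _ _ h1 h2 (A k)) i j hij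
    rw [mlEval_map] at h3
    have h4 : conjHom _ _ h1 h2 (mlEval c A) =
      (1 + Matrix.single i j (1 : K)) * (mlEval c A * (1 - Matrix.single i j (1 : K))) := rfl
    rw [h4, add_mul, mul_sub, mul_sub] at h3
    simp only [Matrix.add_apply, Matrix.sub_apply, one_mul, mul_one, ← mul_assoc] at h3
    have h5 := hcon A i j hij
    have h6 := hcon A j i (Ne.symm hij)
    simp [h5, h6] at h3
    grind
  have : ∃ lam : K, mlEval c A = lam • (1 : Matrix (Fin n) (Fin n) K) := by
    rcases Nat.eq_zero_or_pos n with h0 | h0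
    · subst h0; exact ⟨0, by ext i; exact i.elim0⟩
    · refine ⟨mlEval c A ⟨0, h0⟩ ⟨0, h0⟩, ?_⟩
      ext i j
      by_cases hij : i = j
      · subst hij; simp [hd i ⟨0, h0⟩]
      · simp [Matrix.one_apply_ne hij, hcon A i j hij]
  obtain ⟨lam, hl⟩ := this
  exact hA lam hl

/-- homogeneous matrices of degree `d` -/
def HomMat (e : Fin n ≃ ZMod n) (d : ZMod n) (M : Matrix (Fin n) (Fin n) K) : Prop :=
  ∀ i j, e j ≠ e i + d → M i j = 0

lemma HomMat.list (e : Fin n ≃ ZMod n) : ∀ (m : ℕ) (d : Fin m → ZMod n)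
    (A : Fin m → Matrix (Fin n) (Fin n) K) (_ : ∀ k, HomMat e (d k) (A k)),
    HomMat e (∑ k, d k) (List.ofFn A).prod := by
  intro m
  induction m with
  | zero =>
    intro d A _ i j hij
    simp at hij ⊢
    exact Matrix.one_apply_ne (Ne.symm hij)
  | succ m ih =>
    intro d A h i j hij
    rw [List.ofFn_succ, List.prod_cons, Matrix.mul_apply]
    refine Finset.sum_eq_zero fun k _ => ?_
    by_cases h1 : e k = e i + d 0
    · rw [ih (fun k => d k.succ) _ (fun k => h k.succ) k j, mul_zero]
      rw [h1, add_assoc, ← Fin.sum_univ_succ]; exact hij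
    · rw [h 0 i k h1, zero_mul]

lemma HomMat.mlEv (e : Fin n ≃ ZMod n) (c : Equiv.Perm (Fin m) → K) (d : Fin m → ZMod n)
    (A : Fin m → Matrix (Fin n) (Fin n) K) (h : ∀ k, HomMat e (d k) (A k)) :
    HomMat e (∑ k, d k) (mlEval c A) := by
  intro i j hij
  rw [mlEval, Matrix.sum_apply]
  refine Finset.sum_eq_zero fun σ _ => ?_
  have := HomMat.list e m (fun k => d (σ k)) (fun k => A (σ k)) (fun k => h _)
  rw [Equiv.sum_comp σ d] at this
  rw [Matrix.smul_apply, this i j hij, smul_zero]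

lemma HomMat.combo (e : Fin n ≃ ZMod n) {d : ZMod n} {M N : Matrix (Fin n) (Fin n) K}
    (hM : HomMat e d M) (hN : HomMat e d N) (t : K) : HomMat e d (M + t • (N - M)) := by
  intro i j hij
  simp [hM i j hij, hN i j hij]

open Polynomial in
lemma exists_line (c : Equiv.Perm (Fin m) → K) (A B : Fin m → Matrix (Fin n) (Fin n) K) :
    ∃ M : Matrix (Fin n) (Fin n) K[X], ∀ t : K,
      (evalRingHom t).mapMatrix M = mlEval c (fun k => A k + t • (B k - A k)) := by
  refine ⟨∑ σ : Equiv.Perm (Fin m), (C (c σ)) • (List.ofFn fun k =>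
    (C.mapMatrix (A (σ k)) + (X : K[X]) • C.mapMatrix (B (σ k) - A (σ k)))).prod, fun t => ?_⟩
  rw [map_sum, mlEval]
  refine Finset.sum_congr rfl fun σ _ => ?_
  have hsm : ∀ (a : K[X]) (M : Matrix (Fin n) (Fin n) K[X]),
      (evalRingHom t).mapMatrix (a • M) = a.eval t • (evalRingHom t).mapMatrix M := by
    intro a M; ext i j; simp
  rw [hsm, map_list_prod, List.map_ofFn, eval_C]
  congr 3
  ext k i j
  simp only [Function.comp_apply, map_add, hsm]
  simp

open Polynomial in
lemma exists_common [Infinite K] (c : Equiv.Perm (Fin m) → K) (e : Fin n ≃ ZMod n)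
    (d : Fin m → ZMod n) (S : Finset (Fin n × Fin n))
    (h : ∀ s ∈ S, ∃ A : Fin m → Matrix (Fin n) (Fin n) K, (∀ k, HomMat e (d k) (A k)) ∧
      mlEval c A s.1 s.2 ≠ 0) :
    ∃ A : Fin m → Matrix (Fin n) (Fin n) K, (∀ k, HomMat e (d k) (A k)) ∧
      ∀ s ∈ S, mlEval c A s.1 s.2 ≠ 0 := by
  classical
  induction S using Finset.induction_on with
  | empty => exact ⟨fun _ => 0, fun k i j _ => rfl, by simp⟩
  | insert a S ha ih =>
    obtain ⟨A, hA, hA'⟩ := ih (fun s hs => h s (Finset.mem_insert_of_mem hs))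
    obtain ⟨B, hB, hB'⟩ := h a (Finset.mem_insert_self _ _)
    obtain ⟨M, hM⟩ := exists_line c A B
    have hM' : ∀ t i j, (M i j).eval t = mlEval c (fun k => A k + t • (B k - A k)) i j := by
      intro t i j; rw [← hM]; rfl
    have hne : (∏ s ∈ insert a S, M s.1 s.2) ≠ 0 := by
      rw [Finset.prod_ne_zero_iff]
      intro s hs h0
      rcases Finset.mem_insert.1 hs with rfl | hs
      · have := hM' 1 s.1 s.2
        rw [h0] at this
        simp at this
        exact hB' this.symm
      · have := hM' 0 s.1 s.2
        rw [h0] at this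
        simp at this
        exact hA' s hs this.symm
    obtain ⟨t, ht⟩ : ∃ t, (∏ s ∈ insert a S, M s.1 s.2).eval t ≠ 0 := by
      by_contra! hcon
      exact hne (Polynomial.funext (by simpa using hcon))
    refine ⟨_, fun k => (hA k).combo e (hB k) t, fun s hs h0 => ht ?_⟩
    rw [eval_prod]
    exact Finset.prod_eq_zero hs (by rw [hM', h0])

lemma exists_equiv (hn : 2 ≤ n) (i j : Fin n) (hij : i ≠ j) :
    ∃ e : Fin n ≃ ZMod n, e j = e i + 1 := by
  classical
  have : NeZero n := ⟨by omega⟩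
  have : Fact (1 < n) := ⟨hn⟩
  let e0 : Fin n ≃ ZMod n := Fintype.equivOfCardEq (by simp [ZMod.card])
  let e1 := e0.trans (Equiv.swap (e0 i) 0)
  have h1 : e1 i = 0 := by simp [e1]
  have h2 : e1 j ≠ 0 := by rw [← h1]; exact fun h => hij (e1.injective h).symm
  refine ⟨e1.trans (Equiv.swap (e1 j) 1), ?_⟩
  simp only [Equiv.trans_apply, h1, Equiv.swap_apply_left]
  rw [Equiv.swap_apply_of_ne_of_ne (Ne.symm h2) zero_ne_one, zero_add]

lemma exists_special [Infinite K] (hn : 2 ≤ n) (c : Equiv.Perm (Fin m) → K)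
    (h : ∃ A : Fin m → Matrix (Fin n) (Fin n) K,
        ∀ lam : K, (mlEval c A) ≠ lam • (1 : Matrix (Fin n) (Fin n) K)) :
    ∃ (A : Fin m → Matrix (Fin n) (Fin n) K) (e : Fin n ≃ ZMod n),
      ∀ i j, mlEval c A i j ≠ 0 ↔ e j = e i + 1 := by
  classical
  have : NeZero n := ⟨by omega⟩
  obtain ⟨A, i, j, hij, hA⟩ := exists_offdiag c h
  obtain ⟨e, he⟩ := exists_equiv hn i j hij
  let D : Fin m → ZMod n → Matrix (Fin n) (Fin n) K :=
    fun k d => Matrix.of fun a b => if e b = e a + d then A k a b else 0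
  have hD : ∀ k d, HomMat e d (D k d) := by
    intro k d a b hab
    simp [D, hab]
  have hsum : ∀ k, A k = ∑ d, D k d := by
    intro k
    ext a b
    rw [Matrix.sum_apply, Finset.sum_eq_single (e b - e a)]
    · simp [D]
    · intro d _ hd
      have : e b ≠ e a + d := fun h => hd (by rw [h]; ring)
      simp [D, this]
    · simp
  obtain ⟨d, hd⟩ : ∃ d : Fin m → ZMod n, mlEval c (fun k => D k (d k)) i j ≠ 0 := by
    by_contra! hcon
    apply hA
    rw [← mlMap_apply, show A = fun k => ∑ d, D k d from funext hsum, MultilinearMap.map_sum,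
      Matrix.sum_apply]
    exact Finset.sum_eq_zero fun r _ => by rw [mlMap_apply, hcon]
  have hhom := fun B hB => HomMat.mlEv e c d B hB
  have hs1 : ∑ k, d k = 1 := by
    by_contra hne
    apply hd
    refine hhom _ (fun k => hD k (d k)) i j ?_
    rw [he]
    exact fun h => hne (add_left_cancel h).symm
  rw [hs1] at hhom
  obtain ⟨B, hB, hB'⟩ := exists_common c e d
    (Finset.univ.filter fun s : Fin n × Fin n => e s.2 = e s.1 + 1) (by
      intro s hs
      simp only [Finset.mem_filter, Finset.mem_univ, true_and] at hs
      let π : Fin n ≃ Fin n := e.trans ((Equiv.addRight (e s.1 - e i)).trans e.symm)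
      have hπ : ∀ a, e (π a) = e a + (e s.1 - e i) := by intro a; simp [π]
      refine ⟨fun k => Matrix.reindexAlgEquiv K K π (D k (d k)), ?_, ?_⟩
      · intro k a b hab
        change D k (d k) (π.symm a) (π.symm b) = 0
        apply hD
        intro h1
        apply hab
        have ha := hπ (π.symm a)
        have hb := hπ (π.symm b)
        rw [Equiv.apply_symm_apply] at ha hb
        rw [ha, hb, h1]; ring
      · have h1 := mlEval_map c (fun k => D k (d k)) (Matrix.reindexAlgEquiv K K π).toAlgHom
        have h2 : π i = s.1 := e.injective (by rw [hπ]; ring)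
        have h3 : π j = s.2 := e.injective (by rw [hπ, he, hs]; ring)
        have h4 : mlEval c (fun k => Matrix.reindexAlgEquiv K K π (D k (d k)))
          = Matrix.reindexAlgEquiv K K π (mlEval c (fun k => D k (d k))) := h1
        rw [h4, Matrix.coe_reindexAlgEquiv, Matrix.reindex_apply, Matrix.submatrix_apply,
          ← h2, ← h3, Equiv.symm_apply_apply, Equiv.symm_apply_apply]
        exact hd)
  refine ⟨B, e, fun a b => ⟨fun h => ?_, fun h => hB' (a, b) (by simpa using h)⟩⟩
  by_contra hab
  exact h (hhom B hB a b hab)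

lemma pow_special (e : Fin n ≃ ZMod n) (W : Matrix (Fin n) (Fin n) K)
    (hW : ∀ i j, W i j ≠ 0 ↔ e j = e i + 1) (l : ℕ) :
    ∀ i j, (W ^ l) i j ≠ 0 ↔ e j = e i + l := by
  induction l with
  | zero =>
    intro i j
    simp [Matrix.one_apply, eq_comm]
  | succ l ih =>
    intro i j
    rw [pow_succ, Matrix.mul_apply, Finset.sum_eq_single (e.symm (e j - 1))]
    · rw [mul_ne_zero_iff, ih, hW, Equiv.apply_symm_apply]
      push_cast
      constructor
      · rintro ⟨h, -⟩; linear_combination h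
      · intro h; exact ⟨by linear_combination h, by ring⟩
    · intro b _ hb
      have : W b j = 0 := by
        by_contra h
        apply hb
        rw [← Equiv.symm_apply_apply e b, (hW b j).1 h]
        simp
      rw [this, mul_zero]
    · simp

lemma charpoly_special (hn : 0 < n) (e : Fin n ≃ ZMod n) (W : Matrix (Fin n) (Fin n) K)
    (hW : ∀ i j, W i j ≠ 0 ↔ e j = e i + 1) (k : ℕ) (hk : 0 < k) (hkn : k < n) :
    W.charpoly.coeff k = 0 := by
  have hCH := W.aeval_self_charpoly
  rw [Polynomial.aeval_eq_sum_range, Matrix.charpoly_natDegree_eq_dim, Fintype.card_fin] at hCH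
  let i : Fin n := ⟨0, hn⟩
  have h1 := congrFun (congrFun hCH i) (e.symm (e i + k))
  rw [Matrix.sum_apply, Finset.sum_eq_single k] at h1
  · have h2 := (pow_special e W hW k i (e.symm (e i + k))).2 (by simp)
    simpa [h2] using h1
  · intro l hl hlk
    have : (W ^ l) i (e.symm (e i + k)) = 0 := by
      by_contra h
      have h2 := (pow_special e W hW l _ _).1 h
      rw [Equiv.apply_symm_apply] at h2
      have h3 := (ZMod.natCast_eq_natCast_iff' _ _ _).1 (add_left_cancel h2)
      rw [Finset.mem_range] at hl
      rw [Nat.mod_eq_of_lt hkn] at h3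
      rcases Nat.lt_or_ge l n with h4 | h4
      · rw [Nat.mod_eq_of_lt h4] at h3; omega
      · have : l = n := by omega
        rw [this, Nat.mod_self] at h3; omega
    rw [Matrix.smul_apply, this, smul_zero]
  · intro h; simp at h; omega

open Polynomial in
lemma charpoly_zero [Infinite K] {ν : ℕ} (hν : 0 < ν) (hn : 0 < n)
    (c : Equiv.Perm (Fin m) → K)
    (hsc : ∀ A : Fin m → Matrix (Fin n) (Fin n) K,
      ∃ lam : K, (mlEval c A) ^ ν = lam • (1 : Matrix (Fin n) (Fin n) K))
    (A B : Fin m → Matrix (Fin n) (Fin n) K) (hA : (mlEval c A) ^ ν ≠ 0) (k : ℕ)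
    (hk : (mlEval c A).charpoly.coeff k = 0) :
    (mlEval c B).charpoly.coeff k = 0 := by
  classical
  obtain ⟨M, hM⟩ := exists_line c A B
  let φ := algebraMap K (AlgebraicClosure K)
  obtain ⟨S, hS⟩ := aux_pointwise (L := AlgebraicClosure K) hν hn k
  let i : Fin n := ⟨0, hn⟩
  let s : K[X] := (M ^ ν) i i
  let f : K[X] := M.charpoly.coeff k
  have hs : ∀ t, (mlEval c (fun k => A k + t • (B k - A k))) ^ ν =
      s.eval t • (1 : Matrix (Fin n) (Fin n) K) := by
    intro t
    obtain ⟨lam, hl⟩ := hsc (fun k => A k + t • (B k - A k))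
    have : s.eval t = lam := by
      have h1 : s.eval t = ((evalRingHom t).mapMatrix (M ^ ν)) i i := rfl
      rw [h1, map_pow, hM, hl]
      simp
    rw [this, hl]
  have hf : ∀ t, (mlEval c (fun k => A k + t • (B k - A k))).charpoly.coeff k = f.eval t := by
    intro t
    rw [← hM, RingHom.mapMatrix_apply, Matrix.charpoly_map, coeff_map]
    rfl
  have hprod : (∏ α ∈ S, ((f.map φ) ^ ν - C α * (s.map φ) ^ (n - k))) = 0 := by
    apply Polynomial.eq_zero_of_infinite_isRoot
    refine Set.Infinite.mono ?_ (Set.infinite_range_of_injective φ.injective)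
    rintro _ ⟨t, rfl⟩
    obtain ⟨α, hα, hαe⟩ := hS (φ.mapMatrix (mlEval c (fun k => A k + t • (B k - A k))))
      (φ (s.eval t)) (by
        rw [← map_pow, hs]
        ext a b
        simp [Matrix.one_apply, apply_ite φ])
    rw [RingHom.mapMatrix_apply, Matrix.charpoly_map, coeff_map, hf] at hαe
    rw [Set.mem_ofPred_eq, IsRoot.def, eval_prod]
    refine Finset.prod_eq_zero hα ?_
    simp only [eval_sub, eval_mul, eval_pow, eval_C, eval_map_apply]
    rw [hαe, sub_self]
  obtain ⟨α, hα, hαe⟩ := Finset.prod_eq_zero_iff.1 hprod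
  have hA0 : (fun k => A k + (0 : K) • (B k - A k)) = A := by ext k; simp
  have hB1 : (fun k => A k + (1 : K) • (B k - A k)) = B := by ext k; simp
  have hf0 : f.eval 0 = 0 := by rw [← hf, hA0, hk]
  have hs0 : s.eval 0 ≠ 0 := by
    intro h
    have := hs 0
    rw [hA0, h, zero_smul] at this
    exact hA this
  have hα0 : α = 0 := by
    have h1 := congrArg (eval (φ 0)) hαe
    rw [eval_sub, eval_mul, eval_pow, eval_pow, eval_C, eval_map_apply, eval_map_apply, hf0,
      φ.map_zero, eval_zero, zero_pow hν.ne', zero_sub, neg_eq_zero] at h1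
    exact (mul_eq_zero.1 h1).resolve_right
      (pow_ne_zero _ ((map_ne_zero φ).2 hs0))
  rw [hα0, C_0, zero_mul, sub_zero] at hαe
  have hfz : f = 0 := (Polynomial.map_eq_zero φ).1 (pow_eq_zero_iff hν.ne' |>.1 hαe)
  rw [← hB1, hf, hfz, eval_zero]

end

/-- If `K` is an infinite field (of arbitrary characteristic) and the multilinear
polynomial `p` is `ν`-central on `M_n(K)` for some `ν > 1` (`p^ν` takes only scalar
values, `p^ν` does not vanish identically, and no `p^ℓ` with `1 ≤ ℓ < ν` takes only
scalar values), then `ν = n`. -/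
theorem nu_central_multilinear_eq_n
    {K : Type*} [Field K] [Infinite K] {m n ν : ℕ} (hν : 1 < ν)
    (c : Equiv.Perm (Fin m) → K)
    (hsc : ∀ A : Fin m → Matrix (Fin n) (Fin n) K,
      ∃ lam : K, (mlEval c A) ^ ν = lam • (1 : Matrix (Fin n) (Fin n) K))
    (hnz : ∃ A : Fin m → Matrix (Fin n) (Fin n) K, (mlEval c A) ^ ν ≠ 0)
    (hmin : ∀ ℓ : ℕ, 1 ≤ ℓ → ℓ < ν →
      ∃ A : Fin m → Matrix (Fin n) (Fin n) K,
        ∀ lam : K, (mlEval c A) ^ ℓ ≠ lam • (1 : Matrix (Fin n) (Fin n) K)) :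
    ν = n := by
  have hn0 : n ≠ 0 := by
    rintro rfl
    obtain ⟨A, hA⟩ := hnz
    exact hA (by ext i; exact i.elim0)
  have hn1 : n ≠ 1 := by
    rintro rfl
    obtain ⟨A, hA⟩ := hmin 1 le_rfl hν
    refine hA (mlEval c A 0 0) ?_
    ext i j
    rw [Subsingleton.elim i 0, Subsingleton.elim j 0]
    simp
  have hn : 2 ≤ n := by omega
  obtain ⟨A, e, hA⟩ := exists_special hn c (by simpa using hmin 1 le_rfl hν)
  have hpow := pow_special e _ hA ν
  let i : Fin n := ⟨0, by omega⟩
  have hne := (hpow i (e.symm (e i + ν))).2 (by simp)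
  have hdvd : n ∣ ν := by
    obtain ⟨lam, hl⟩ := hsc A
    rw [hl] at hne
    have h1 : i = e.symm (e i + ν) := by
      by_contra h
      exact hne (by simp [Matrix.one_apply_ne h])
    have h2 := congrArg e h1
    rw [Equiv.apply_symm_apply] at h2
    exact (ZMod.natCast_eq_zero_iff _ _).1 (left_eq_add.1 h2)
  have hle : ν ≤ n := by
    by_contra! hlt
    obtain ⟨B, hB⟩ := hmin n (by omega) hlt
    apply hB (-(mlEval c B).charpoly.coeff 0)
    have hz : ∀ k, 0 < k → k < n → (mlEval c B).charpoly.coeff k = 0 := fun k hk hkn =>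
      charpoly_zero (by omega) (by omega) c hsc A B (fun h => hne (by rw [h]; rfl)) k
        (charpoly_special (by omega) e _ hA k hk hkn)
    have hCH := (mlEval c B).aeval_self_charpoly
    have hlead : (mlEval c B).charpoly.coeff n = 1 := by
      have := (mlEval c B).charpoly_monic.coeff_natDegree
      rwa [Matrix.charpoly_natDegree_eq_dim, Fintype.card_fin] at this
    rw [Polynomial.aeval_eq_sum_range, Matrix.charpoly_natDegree_eq_dim, Fintype.card_fin,
      Finset.sum_range_succ, hlead, Finset.sum_eq_single 0] at hCH
    · rw [pow_zero, one_smul] at hCH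
      rw [neg_smul]
      exact eq_neg_of_add_eq_zero_right hCH
    · intro k hk hk0
      rw [hz k (Nat.pos_of_ne_zero hk0) (Finset.mem_range.1 hk), zero_smul]
    · intro h; simp at h; omega
  exact le_antisymm hle (Nat.le_of_dvd (by omega) hdvd)
end

section
/- Let K be an infinite field (of arbitrary characteristic) and let n ≥ 4. Then there is no multilinear power-central polynomial for M_n(K): there do not exist m ≥ 1, a multilinear polynomial p in m variables over K, and an integer ν ≥ 2 such that p does not take only scalar values on M_n(K), p^ν takes only scalar values on M_n(K), and p^ν does not vanish identically on M_n(K). -/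
namespace MLPC

/-- The multilinear polynomial evaluated in an arbitrary `K`-algebra. -/
noncomputable def gEval {K : Type*} [Field K] {R : Type*} [Ring R] [Algebra K R] {m : ℕ}
    (c : Equiv.Perm (Fin m) → K) (A : Fin m → R) : R :=
  ∑ σ : Equiv.Perm (Fin m), c σ • (List.ofFn fun k => A (σ k)).prod

lemma gEval_map {K : Type*} [Field K] {R S : Type*} [Ring R] [Algebra K R] [Ring S] [Algebra K S]
    {m : ℕ} (c : Equiv.Perm (Fin m) → K) (φ : R →ₐ[K] S) (A : Fin m → R) :
    gEval c (fun k => φ (A k)) = φ (gEval c A) := by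
  simp only [gEval, map_sum, map_smul, map_list_prod, List.map_ofFn]
  rfl

/-- Conjugation as an algebra homomorphism. -/
noncomputable def conjHom {K : Type*} [Field K] {R : Type*} [Ring R] [Algebra K R]
    (g h : R) (hg : g * h = 1) (hh : h * g = 1) : R →ₐ[K] R :=
  AlgHom.ofLinearMap
    { toFun := fun x => g * x * h
      map_add' := fun x y => by rw [mul_add, add_mul]
      map_smul' := fun r x => by simp }
    (by simpa using hg)
    (fun x y => by
      change g * (x * y) * h = g * x * h * (g * y * h)
      calc g * (x * y) * h = g * x * 1 * y * h := by simp only [mul_assoc, one_mul]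
        _ = g * x * (h * g) * y * h := by rw [hh]
        _ = _ := by simp only [mul_assoc])

/-- Homogeneity with respect to the grading defined by a labelling. -/
def Homog {R G ι : Type*} [Zero R] [AddCommGroup G] (e : ι → G) (d : G) (A : Matrix ι ι R) : Prop :=
  ∀ i j, A i j ≠ 0 → e j - e i = d

lemma homog_list {R G ι κ : Type*} [CommRing R] [AddCommGroup G] [Fintype ι] [DecidableEq ι]
    (e : ι → G) (d : κ → G) (B : κ → Matrix ι ι R) (hB : ∀ k, Homog e (d k) (B k)) (l : List κ) :
    Homog e (l.map d).sum (l.map B).prod := by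
  induction l with
  | nil =>
    intro i j h
    by_cases hij : i = j
    · simp [hij]
    · simp [hij] at h
  | cons a l ih =>
    intro i j h
    rw [List.map_cons, List.prod_cons, Matrix.mul_apply] at h
    obtain ⟨k, -, hk⟩ := Finset.exists_ne_zero_of_sum_ne_zero h
    have h1 := hB a i k (left_ne_zero_of_mul hk)
    have h2 := ih k j (right_ne_zero_of_mul hk)
    rw [List.map_cons, List.sum_cons, ← h1, ← h2]
    abel

lemma homog_gEval {K R G ι : Type*} [Field K] [CommRing R] [Algebra K R] [AddCommGroup G]
    [Fintype ι] [DecidableEq ι] {m : ℕ} (c : Equiv.Perm (Fin m) → K)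
    (e : ι → G) (d : Fin m → G) (B : Fin m → Matrix ι ι R) (hB : ∀ k, Homog e (d k) (B k)) :
    Homog e (∑ k, d k) (gEval c B) := by
  intro i j h
  rw [gEval, Matrix.sum_apply] at h
  obtain ⟨σ, -, hσ⟩ := Finset.exists_ne_zero_of_sum_ne_zero h
  rw [Matrix.smul_apply] at hσ
  have h1 : (List.ofFn fun k => B (σ k)).prod i j ≠ 0 := fun h0 => hσ (by rw [h0, smul_zero])
  rw [List.ofFn_eq_map] at h1
  have := homog_list e (fun k => d (σ k)) (fun k => B (σ k)) (fun k => hB _) (List.finRange m) i j h1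
  rw [this, ← List.ofFn_eq_map, List.sum_ofFn]
  exact Equiv.sum_comp σ d

/-- The multilinear map attached to the polynomial. -/
noncomputable def gMulti {K : Type*} [Field K] (R : Type*) [Ring R] [Algebra K R] {m : ℕ}
    (c : Equiv.Perm (Fin m) → K) : MultilinearMap K (fun _ : Fin m => R) R :=
  ∑ σ : Equiv.Perm (Fin m), c σ • (MultilinearMap.mkPiAlgebraFin K m R).domDomCongr σ

lemma gMulti_apply {K : Type*} [Field K] {R : Type*} [Ring R] [Algebra K R] {m : ℕ}
    (c : Equiv.Perm (Fin m) → K) (A : Fin m → R) : gMulti R c A = gEval c A := by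
  simp [gMulti, gEval]

lemma step1 {K ι : Type*} [Field K] [Fintype ι] [DecidableEq ι] {m : ℕ}
    (hι : 3 ≤ Fintype.card ι)
    (c : Equiv.Perm (Fin m) → K) (A : Fin m → Matrix ι ι K)
    (hA : ∀ lam : K, gEval c A ≠ lam • (1 : Matrix ι ι K)) :
    ∃ (r s : Fin m → ι) (i j : ι),
      gEval c (fun k => Matrix.single (r k) (s k) (1 : K)) i i ≠
      gEval c (fun k => Matrix.single (r k) (s k) (1 : K)) j j := by
  by_contra! hcon
  have key : ∀ (B : Fin m → Matrix ι ι K) (i j : ι), gEval c B i i = gEval c B j j := by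
    intro B i j
    have : (Matrix.entryLinearMap K K i i).compMultilinearMap (gMulti (Matrix ι ι K) c) =
        (Matrix.entryLinearMap K K j j).compMultilinearMap (gMulti (Matrix ι ι K) c) := by
      refine Module.Basis.ext_multilinear (fun _ => Matrix.stdBasis K ι ι) ?_
      intro v
      have hv : (fun k => Matrix.stdBasis K ι ι (v k)) =
          fun k => Matrix.single (v k).1 (v k).2 (1 : K) := by
        funext k
        exact Matrix.stdBasis_eq_single K (v k).1 (v k).2
      rw [hv]
      simpa [gMulti_apply] using hcon (fun k => (v k).1) (fun k => (v k).2) i j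
    have h2 := congrArg (fun f => f B) this
    simpa [gMulti_apply] using h2
  have hoff : ∀ i j, i ≠ j → gEval c A i j = 0 := by
    intro i j hij
    obtain ⟨l, hl⟩ : ∃ l, l ∉ ({i, j} : Finset ι) := by
      by_contra! h
      have := Finset.card_le_card (fun x _ => h x : (Finset.univ : Finset ι) ⊆ {i, j})
      have h2 := Finset.card_le_two (a := i) (b := j)
      rw [Finset.card_univ] at this
      omega
    simp only [Finset.mem_insert, Finset.mem_singleton, not_or] at hl
    have hs : Matrix.single j i (1 : K) * Matrix.single j i (1 : K) = 0 := by
      rw [Matrix.single_mul_single_of_ne]; exact hij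
    have h1 := gEval_map c (conjHom (K := K) (1 + Matrix.single j i (1 : K))
      (1 - Matrix.single j i (1 : K)) (by rw [add_mul, mul_sub, mul_sub, hs]; simp) (by rw [sub_mul, mul_add, mul_add, hs]; simp)) A
    have h2 := key _ j l |>.symm.trans (congrFun (congrFun h1 j) j) |>.symm
    have h3 := h2.trans (congrFun (congrFun h1 l) l)
    simp only [conjHom, AlgHom.ofLinearMap_apply, LinearMap.coe_mk, AddHom.coe_mk] at h3
    have h4 := key A j l
    generalize gEval c A = M at h3 h4 ⊢
    rw [mul_sub, mul_one, add_mul, one_mul] at h3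
    simp only [Matrix.sub_apply, Matrix.add_apply] at h3
    rw [Matrix.mul_single_apply_of_ne (hbj := hij.symm), Matrix.mul_single_apply_of_ne (hbj := hl.1),
      Matrix.single_mul_apply_same, Matrix.single_mul_apply_of_ne (h := hl.2)] at h3
    simpa [h4] using h3
  obtain ⟨i0⟩ : Nonempty ι := Fintype.card_pos_iff.mp (by omega)
  apply hA (gEval c A i0 i0)
  ext i j
  by_cases hij : i = j
  · subst hij; simp [key A i i0]
  · simp [hoff i j hij, hij]

lemma poly_rel {K : Type*} [Field K] {ν : ℕ} (hν : ν ≠ 0) (p q : Polynomial K)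
    (h : p ^ ν = q ^ ν) (a b : K) : p.eval a * q.eval b = q.eval a * p.eval b := by
  have h1 : Associated (p ^ ν) (q ^ ν) := by rw [h]
  obtain ⟨u, hu⟩ := (Associated.pow_iff hν).1 h1
  obtain ⟨z, hz, hz2⟩ := Polynomial.isUnit_iff.1 u.isUnit
  rw [← hu, ← hz2]
  simp
  ring

open Polynomial in
lemma step3 {K ι G : Type*} [Field K] [Infinite K] [Fintype ι] [DecidableEq ι] [AddCommGroup G]
    {m ν : ℕ} (hν : ν ≠ 0) (c : Equiv.Perm (Fin m) → K)
    (hc : ∀ A : Fin m → Matrix ι ι K, ∃ lam : K, gEval c A ^ ν = lam • (1 : Matrix ι ι K))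
    (r s : Fin m → ι) (i0 : ι)
    (h0 : gEval c (fun k => Matrix.single (r k) (s k) (1 : K)) i0 i0 ≠ 0)
    (e : ι → G) (he : Function.Injective e) (σ : Equiv.Perm ι) (t : G)
    (hσ : ∀ i, e (σ i) = e i + t) (D : ι → K)
    (hD : ∀ i, D i = gEval c (fun k => Matrix.single (r k) (s k) (1 : K)) i i) :
    (∀ i j, D i ^ ν = D j ^ ν) ∧ ∀ a b, D (σ a) * D b = D (σ b) * D a := by
  set d : Fin m → G := fun k => e (s k) - e (r k) with hd
  have hsingle : ∀ k, Homog e (d k) (Matrix.single (r k) (s k) (1 : K)) := by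
    intro k i j h
    by_cases h2 : r k = i ∧ s k = j
    · simp only [hd, h2.1, h2.2]
    · rw [Matrix.single_apply_of_ne _ _ _ _ _ h2] at h
      exact absurd rfl h
  have hsum : ∑ k, d k = 0 := by
    rw [← homog_gEval c e d _ hsingle i0 i0 h0, sub_self]
  let B : Fin m → Matrix ι ι K[X] := fun k =>
    Matrix.single (r k) (s k) (1 - X) + Matrix.single (σ (r k)) (σ (s k)) X
  have hB : ∀ k, Homog e (d k) (B k) := by
    intro k i j h
    by_cases h2 : r k = i ∧ s k = j
    · simp only [hd, h2.1, h2.2]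
    by_cases h3 : σ (r k) = i ∧ σ (s k) = j
    · simp only [hd, ← h3.1, ← h3.2, hσ]; abel
    · simp only [B, Matrix.add_apply] at h
      rw [Matrix.single_apply_of_ne _ _ _ _ _ h2, Matrix.single_apply_of_ne _ _ _ _ _ h3] at h
      simp at h
  have hBd : gEval c B = Matrix.diagonal (fun i => gEval c B i i) := by
    ext1 i j
    by_cases hij : i = j
    · subst hij; simp
    · rw [Matrix.diagonal_apply_ne _ hij]
      by_contra h
      have := homog_gEval c e d B hB i j h
      rw [hsum, sub_eq_zero] at this
      exact hij (he this).symm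
  set f : ι → K[X] := fun i => gEval c B i i with hf
  have hev : ∀ u : K, gEval c (fun k => (aeval u : K[X] →ₐ[K] K).mapMatrix (B k)) =
      Matrix.diagonal (fun i => (f i).eval u) := by
    intro u
    rw [gEval_map, hBd]
    ext i j
    by_cases hij : i = j
    · subst hij; simp [coe_aeval_eq_eval]
    · simp [hij]
  have hpow : ∀ i j, f i ^ ν = f j ^ ν := by
    intro i j
    apply Polynomial.funext
    intro u
    obtain ⟨lam, hl⟩ := hc (fun k => (aeval u : K[X] →ₐ[K] K).mapMatrix (B k))
    rw [hev, Matrix.diagonal_pow] at hl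
    have h1 := congrFun (congrFun hl i) i
    have h2 := congrFun (congrFun hl j) j
    simp at h1 h2
    simp [h1, h2]
  have hms : ∀ (u : K) (i j : ι) (q : K[X]), (aeval u : K[X] →ₐ[K] K).mapMatrix (Matrix.single i j q) =
      Matrix.single i j (q.eval u) := by
    intro u i j q
    rw [AlgHom.mapMatrix_apply, Matrix.map_single, coe_aeval_eq_eval]
  have hB0 : (fun k => (aeval (0 : K) : K[X] →ₐ[K] K).mapMatrix (B k)) =
      fun k => Matrix.single (r k) (s k) (1 : K) := by
    funext k
    simp only [B, map_add, hms]
    simp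
  have hB1 : (fun k => (aeval (1 : K) : K[X] →ₐ[K] K).mapMatrix (B k)) =
      fun k => (Matrix.reindexAlgEquiv K K σ).toAlgHom (Matrix.single (r k) (s k) (1 : K)) := by
    funext k
    simp only [B, map_add, hms]
    simp
  have hf0 : ∀ i, (f i).eval 0 = D i := by
    intro i
    have := congrFun (congrFun (hev 0) i) i
    rw [hB0, ← hD] at this
    simpa using this.symm
  have hf1 : ∀ i, (f (σ i)).eval 1 = D i := by
    intro i
    have := congrFun (congrFun (hev 1) (σ i)) (σ i)
    rw [hB1, gEval_map] at this
    simp at this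
    rw [hD, ← this]
  refine ⟨fun i j => ?_, fun a b => ?_⟩
  · rw [← hf0, ← hf0, ← eval_pow, ← eval_pow, hpow]
  · have := poly_rel hν (f (σ a)) (f (σ b)) (hpow _ _) 0 1
    rwa [hf0, hf0, hf1, hf1] at this

lemma exists_label {k : ℕ} (x y z : Fin (k + 4)) (hxy : x ≠ y) (hxz : x ≠ z) (hyz : y ≠ z) :
    ∃ (e σ : Equiv.Perm (Fin (k + 4))), (∀ i, e (σ i) = e i + 1) ∧ σ x = y ∧ σ y = z := by
  obtain ⟨e, hx, hy, hz⟩ : ∃ e : Equiv.Perm (Fin (k + 4)), e x = 0 ∧ e y = 1 ∧ e z = 1 + 1 := by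
    have h01 : (0 : Fin (k + 4)) ≠ 1 := by simp
    have h2 : ((1 + 1 : Fin (k + 4)) : ℕ) = 2 := by
      rw [Fin.val_add, Fin.val_one]; exact Nat.mod_eq_of_lt (by omega)
    have h02 : (0 : Fin (k + 4)) ≠ 1 + 1 := by rw [Ne, Fin.ext_iff, h2]; simp
    have h12 : (1 : Fin (k + 4)) ≠ 1 + 1 := by rw [Ne, Fin.ext_iff, h2]; simp
    let e1 := Equiv.swap x (0 : Fin (k + 4))
    have e1x : e1 x = 0 := Equiv.swap_apply_left _ _
    let e2 := Equiv.swap (e1 y) 1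
    have h1 : e1 y ≠ 0 := by rw [← e1x]; exact fun h => hxy (e1.injective h).symm
    have e20 : e2 0 = 0 := Equiv.swap_apply_of_ne_of_ne h1.symm h01
    have e2y : e2 (e1 y) = 1 := Equiv.swap_apply_left _ _
    let e3 := Equiv.swap (e2 (e1 z)) (1 + 1)
    have h3 : e2 (e1 z) ≠ 0 := by
      rw [← e20, ← e1x]; exact fun h => hxz (e1.injective (e2.injective h)).symm
    have h4 : e2 (e1 z) ≠ 1 := by
      rw [← e2y]; exact fun h => hyz (e1.injective (e2.injective h)).symm
    refine ⟨e1.trans (e2.trans e3), ?_, ?_, ?_⟩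
    · simp only [Equiv.trans_apply]
      rw [e1x, e20]; exact Equiv.swap_apply_of_ne_of_ne h3.symm h02
    · simp only [Equiv.trans_apply]
      rw [e2y]; exact Equiv.swap_apply_of_ne_of_ne h4.symm h12
    · simp only [Equiv.trans_apply]
      exact Equiv.swap_apply_left _ _
  refine ⟨e, e.trans ((Equiv.addRight 1).trans e.symm), ?_, ?_, ?_⟩
  · intro i; simp
  · simp [hx, ← hy]
  · simp [hy, ← hz]

end MLPC

/-- For an infinite field `K` (of arbitrary characteristic) and `n ≥ 4` there is no
multilinear power-central polynomial for `M_n(K)`: there are no `m ≥ 1`, multilinear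
polynomial `p` in `m` variables, and `ν ≥ 2` such that `p` does not take only scalar
values, while `p^ν` takes only scalar values and does not vanish identically. -/
theorem no_multilinear_power_central_polynomials
    {K : Type*} [Field K] [Infinite K] {n : ℕ} (hn : 4 ≤ n) :
    ¬ ∃ (m : ℕ) (_ : 1 ≤ m) (c : Equiv.Perm (Fin m) → K) (ν : ℕ) (_ : 2 ≤ ν),
      (∃ A : Fin m → Matrix (Fin n) (Fin n) K,
        ∀ lam : K, mlEval c A ≠ lam • (1 : Matrix (Fin n) (Fin n) K)) ∧
      (∀ A : Fin m → Matrix (Fin n) (Fin n) K,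
        ∃ lam : K, (mlEval c A) ^ ν = lam • (1 : Matrix (Fin n) (Fin n) K)) ∧
      (∃ A : Fin m → Matrix (Fin n) (Fin n) K, (mlEval c A) ^ ν ≠ 0) := by
  rintro ⟨m, -, c, ν, hν, ⟨A, hA⟩, hc, -⟩
  obtain ⟨k, rfl⟩ : ∃ k, n = k + 4 := ⟨n - 4, by omega⟩
  obtain ⟨r, s, i, j, hij⟩ := MLPC.step1 (by simp) c A hA
  have hν0 : ν ≠ 0 := by omega
  obtain ⟨D, hD⟩ : ∃ D : Fin (k + 4) → K, ∀ i, D i =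
      MLPC.gEval c (fun k => Matrix.single (r k) (s k) (1 : K)) i i := ⟨_, fun _ => rfl⟩
  rw [← hD, ← hD] at hij
  obtain ⟨i0, h0⟩ : ∃ i0, D i0 ≠ 0 := by
    by_contra! h
    exact hij (by rw [h, h])
  have hnz := h0
  rw [hD] at hnz
  have main := fun (e σ : Equiv.Perm (Fin (k + 4))) (h : ∀ i, e (σ i) = e i + 1) =>
    MLPC.step3 hν0 c hc r s i0 hnz e e.injective σ 1 h D hD
  have hne : i ≠ j := fun h => hij (by rw [h])
  obtain ⟨x, hx⟩ : ∃ x, x ∉ ({i, j} : Finset (Fin (k + 4))) := by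
    by_contra! h
    have h1 := Finset.card_le_card (fun x _ => h x : (Finset.univ : Finset (Fin (k + 4))) ⊆ {i, j})
    have h2 := Finset.card_le_two (a := i) (b := j)
    rw [Finset.card_univ, Fintype.card_fin] at h1
    omega
  obtain ⟨y, hy⟩ : ∃ y, y ∉ ({i, j, x} : Finset (Fin (k + 4))) := by
    by_contra! h
    have h1 := Finset.card_le_card
      (fun x _ => h x : (Finset.univ : Finset (Fin (k + 4))) ⊆ {i, j, x})
    have h2 := Finset.card_le_three (a := i) (b := j) (c := x)
    rw [Finset.card_univ, Fintype.card_fin] at h1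
    omega
  simp only [Finset.mem_insert, Finset.mem_singleton, not_or] at hx hy
  obtain ⟨e, σ, h1, h2, h3⟩ := MLPC.exists_label i x y (Ne.symm hx.1) (Ne.symm hy.1) (Ne.symm hy.2.2)
  obtain ⟨e₂, σ₂, h4, h5, h6⟩ :=
    MLPC.exists_label j x y (Ne.symm hx.2) (Ne.symm hy.2.1) (Ne.symm hy.2.2)
  have hy0 : D y ≠ 0 := by
    intro h
    have := (main e σ h1).1 i0 y
    rw [h, zero_pow hν0] at this
    exact h0 (pow_eq_zero_iff hν0 |>.1 this)
  have r1 := (main e σ h1).2 i x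
  have r2 := (main e₂ σ₂ h4).2 j x
  rw [h2, h3] at r1
  rw [h5, h6] at r2
  exact hij (mul_left_cancel₀ hy0 (r1.symm.trans r2))
end
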